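/- arXiv:0802.4272 — 2 statements merged into one kernel-verified Lean document; each statement's English description precedes it below -/
import Mathlib

section
/- There is a constant C depending only on K such that, provided C·b ≤ 1/2, most contracted unit directions e_i(a) of M^{(i)}(a) can be chosen depending C¹ on a ∈ J, and they satisfy: ‖∂_a e_i(a)‖ ≤ C for all 1 ≤ i ≤ n and a ∈ J; ‖∂_a (e_{i+1}(a) − e_i(a))‖ ≤ (C·b)^i for all 1 ≤ i < n; and ‖∂_a (M^{(i)}(a)·e_n(a))‖ ≤ (C·b)^i for all 1 ≤ i ≤ n. -/
/-- `f` is differentiable at `a` and its value and derivative there have total norm at most `c`. -/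
def JetBound {E : Type*} [NormedAddCommGroup E] [NormedSpace ℝ E] (f : ℝ → E) (a c : ℝ) : Prop :=
  DifferentiableAt ℝ f a ∧ ‖f a‖ + ‖deriv f a‖ ≤ c

namespace JetBound

section Vector

variable {E : Type*} [NormedAddCommGroup E] [NormedSpace ℝ E] {f g : ℝ → E} {a c d : ℝ}

lemma mono (h : JetBound f a c) (hcd : c ≤ d) : JetBound f a d := ⟨h.1, h.2.trans hcd⟩

lemma norm_le (h : JetBound f a c) : ‖f a‖ ≤ c := by
  have := h.2; have := norm_nonneg (deriv f a); linarith

lemma norm_deriv_le (h : JetBound f a c) : ‖deriv f a‖ ≤ c := by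
  have := h.2; have := norm_nonneg (f a); linarith

lemma nonneg (h : JetBound f a c) : 0 ≤ c := (norm_nonneg _).trans h.norm_le

lemma add (hf : JetBound f a c) (hg : JetBound g a d) :
    JetBound (fun t => f t + g t) a (c + d) := by
  refine ⟨hf.1.add hg.1, ?_⟩
  rw [(hf.1.hasDerivAt.fun_add hg.1.hasDerivAt).deriv]
  have := hf.2; have := hg.2
  have := norm_add_le (f a) (g a); have := norm_add_le (deriv f a) (deriv g a)
  linarith

lemma sub (hf : JetBound f a c) (hg : JetBound g a d) :
    JetBound (fun t => f t - g t) a (c + d) := by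
  refine ⟨hf.1.sub hg.1, ?_⟩
  rw [(hf.1.hasDerivAt.fun_sub hg.1.hasDerivAt).deriv]
  have := hf.2; have := hg.2
  have := norm_sub_le (f a) (g a); have := norm_sub_le (deriv f a) (deriv g a)
  linarith

lemma congr (hf : JetBound f a c) (h : g =ᶠ[nhds a] f) : JetBound g a c := by
  refine ⟨hf.1.congr_of_eventuallyEq h, ?_⟩
  rw [h.deriv_eq, h.eq_of_nhds]; exact hf.2

end Vector

variable {f g : ℝ → ℝ} {a c d : ℝ}

lemma const (x : ℝ) (hx : |x| ≤ c) : JetBound (fun _ => x) a c :=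
  ⟨differentiableAt_const x, by simpa using hx⟩

lemma mul (hf : JetBound f a c) (hg : JetBound g a d) :
    JetBound (fun t => f t * g t) a (c * d) := by
  refine ⟨hf.1.mul hg.1, ?_⟩
  rw [(hf.1.hasDerivAt.fun_mul hg.1.hasDerivAt).deriv]
  have h1 := norm_add_le (deriv f a * g a) (f a * deriv g a)
  have h2 := mul_le_mul hf.2 hg.2 (by positivity) hf.nonneg
  simp only [norm_mul] at *
  nlinarith [mul_nonneg (norm_nonneg (deriv f a)) (norm_nonneg (deriv g a))]

lemma smul_const {E : Type*} [NormedAddCommGroup E] [NormedSpace ℝ E] (hf : JetBound f a c)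
    {v : E} (hv : ‖v‖ = 1) : JetBound (fun t => f t • v) a c := by
  refine ⟨hf.1.smul_const v, ?_⟩
  rw [(hf.1.hasDerivAt.smul_const v).deriv]
  simpa [norm_smul, hv] using hf.2

lemma inv (hf : JetBound f a c) (h : 1 / 2 ≤ |f a|) : JetBound (fun t => (f t)⁻¹) a (4 * c) := by
  have h0 : f a ≠ 0 := fun h0 => by norm_num [h0] at h
  have hp : 0 < |f a| := abs_pos.2 h0
  have h4 : 1 ≤ 4 * |f a| ^ 2 := by nlinarith
  refine ⟨hf.1.inv h0, ?_⟩
  rw [(hf.1.hasDerivAt.fun_inv h0).deriv]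
  have h2 := hf.2
  simp only [norm_div, norm_neg, norm_pow, norm_inv, Real.norm_eq_abs] at *
  have e1 : |f a|⁻¹ ≤ 4 * |f a| := by
    rw [inv_le_iff_one_le_mul₀ hp]; nlinarith
  have e2 : |deriv f a| / |f a| ^ 2 ≤ 4 * |deriv f a| := by
    rw [div_le_iff₀ (by positivity)]; nlinarith [abs_nonneg (deriv f a)]
  linarith

lemma sqrt (hf : JetBound f a c) (h : 1 / 4 ≤ f a) : JetBound (fun t => √(f t)) a (2 * c) := by
  have h0 : f a ≠ 0 := by linarith
  have hs : 1 / 2 ≤ √(f a) := Real.le_sqrt_of_sq_le (by linarith)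
  have hsq := Real.sq_sqrt (show 0 ≤ f a by linarith)
  refine ⟨hf.1.sqrt h0, ?_⟩
  rw [(hf.1.hasDerivAt.sqrt h0).deriv]
  have h2 := hf.2
  simp only [norm_div, norm_mul, Real.norm_eq_abs, abs_of_nonneg (Real.sqrt_nonneg (f a)),
    abs_two] at *
  have e1 : √(f a) ≤ 2 * |f a| := by
    rw [abs_of_nonneg (by linarith)]; nlinarith
  have e2 : |deriv f a| / (2 * √(f a)) ≤ |deriv f a| := by
    rw [div_le_iff₀ (by positivity)]; nlinarith [abs_nonneg (deriv f a)]
  linarith [abs_nonneg (deriv f a)]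

end JetBound

section Coordinates

variable (A B C D : ℕ → ℝ → ℝ)

/-- The slope of the image of the first basis vector under the product of the first `i` matrices
`[[A j, B j], [C j, D j]]`, `1 ≤ j ≤ i`. -/
noncomputable def imageSlope : ℕ → ℝ → ℝ
  | 0 => fun _ => 0
  | i + 1 => fun t => (C (i + 1) t + D (i + 1) t * imageSlope i t) *
      (A (i + 1) t + B (i + 1) t * imageSlope i t)⁻¹

/-- The factor by which the `i + 1`-st matrix multiplies the top left entry of the product. -/
noncomputable def pivot (i : ℕ) (t : ℝ) : ℝ := A (i + 1) t + B (i + 1) t * imageSlope A B C D i t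

/-- The top left entry of the product of the first `i` matrices. -/
noncomputable def corner : ℕ → ℝ → ℝ
  | 0 => fun _ => 1
  | i + 1 => fun t => corner i t * pivot A B C D i t

/-- The determinant of the product of the first `i` matrices over the square of its top left
entry. -/
noncomputable def relDet : ℕ → ℝ → ℝ
  | 0 => fun _ => 1
  | i + 1 => fun t => relDet i t * ((A (i + 1) t * D (i + 1) t - B (i + 1) t * C (i + 1) t) *
      ((pivot A B C D i t)⁻¹ * (pivot A B C D i t)⁻¹))

/-- The ratio of the two entries in the first row of the product of the first `i` matrices. -/
noncomputable def rowRatio : ℕ → ℝ → ℝ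
  | 0 => fun _ => 0
  | i + 1 => fun t => rowRatio i t +
      B (i + 1) t * relDet A B C D i t * (pivot A B C D i t)⁻¹

/-- Bounds at the parameter `a` for the first `n` matrices. -/
structure FamilyBound (K b : ℝ) (n : ℕ) (a : ℝ) : Prop where
  two_le : ∀ i < n, 2 ≤ |A (i + 1) a|
  jetA : ∀ i < n, JetBound (A (i + 1)) a (2 * K)
  jetB : ∀ i < n, JetBound (B (i + 1)) a (2 * K)
  jetC : ∀ i < n, JetBound (C (i + 1)) a (2 * K * b)
  jetD : ∀ i < n, JetBound (D (i + 1)) a (2 * K * b)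

namespace FamilyBound

variable {A B C D} {K b a : ℝ} {n : ℕ}

lemma pivot_of_slope (h : FamilyBound A B C D K b n a) (hK : 2 ≤ K) {i : ℕ}
    (hi : i < n) (hs : JetBound (imageSlope A B C D i) a (1 / (4 * K))) :
    1 / 2 ≤ |pivot A B C D i a| ∧ JetBound (pivot A B C D i) a (3 * K) := by
  have hm := (h.jetB i hi).mul hs
  have hc : 2 * K * (1 / (4 * K)) = 1 / 2 := by field_simp; norm_num
  rw [hc] at hm
  refine ⟨?_, ((h.jetA i hi).add hm).mono (by linarith)⟩
  have h1 := hm.norm_le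
  have h2 := h.two_le i hi
  rw [Real.norm_eq_abs] at h1
  have h3 := abs_sub_abs_le_abs_sub (A (i + 1) a) (-(B (i + 1) a * imageSlope A B C D i a))
  rw [abs_neg, sub_neg_eq_add] at h3
  unfold pivot
  linarith

lemma jet_slope (h : FamilyBound A B C D K b n a) (hK : 2 ≤ K) (hb : 0 < b)
    (hq : 1152 * K ^ 4 * b ≤ 1 / 4) : ∀ i ≤ n,
    JetBound (imageSlope A B C D i) a (1 / (4 * K)) := by
  intro i
  induction i with
  | zero => intro _; exact JetBound.const 0 (by simp; linarith)
  | succ i ih =>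
    intro hi
    have hs := ih (by omega)
    obtain ⟨hp, hpj⟩ := h.pivot_of_slope hK (by omega) hs
    have hs1 : JetBound (imageSlope A B C D i) a 1 := hs.mono (by
      rw [div_le_iff₀ (by linarith)]; linarith)
    refine (((h.jetC i (by omega)).add ((h.jetD i (by omega)).mul hs1)).mul
      (hpj.inv hp)).mono ?_
    rw [le_div_iff₀ (by linarith)]
    have : K ^ 3 * b * 2 ≤ K ^ 3 * b * K := by
      gcongr
    nlinarith

lemma pivot_bounds (h : FamilyBound A B C D K b n a) (hK : 2 ≤ K) (hb : 0 < b)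
    (hq : 1152 * K ^ 4 * b ≤ 1 / 4) {i : ℕ} (hi : i < n) :
    1 / 2 ≤ |pivot A B C D i a| ∧ JetBound (pivot A B C D i) a (3 * K) :=
  h.pivot_of_slope hK hi (h.jet_slope hK hb hq i hi.le)

lemma jet_slope_one (h : FamilyBound A B C D K b n a) (hK : 2 ≤ K) (hb : 0 < b)
    (hq : 1152 * K ^ 4 * b ≤ 1 / 4) {i : ℕ} (hi : i ≤ n) : JetBound (imageSlope A B C D i) a 1 :=
  (h.jet_slope hK hb hq i hi).mono (by rw [div_le_iff₀ (by linarith)]; linarith)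

lemma jet_corner (h : FamilyBound A B C D K b n a) (hK : 2 ≤ K) (hb : 0 < b)
    (hq : 1152 * K ^ 4 * b ≤ 1 / 4) : ∀ i ≤ n,
    JetBound (corner A B C D i) a ((3 * K) ^ i) := by
  intro i
  induction i with
  | zero => intro _; exact JetBound.const 1 (by simp)
  | succ i ih =>
    intro hi
    rw [pow_succ]
    exact (ih (by omega)).mul (h.pivot_bounds hK hb hq (by omega)).2

lemma jet_relDet (h : FamilyBound A B C D K b n a) (hK : 2 ≤ K) (hb : 0 < b)
    (hq : 1152 * K ^ 4 * b ≤ 1 / 4) : ∀ i ≤ n,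
    JetBound (relDet A B C D i) a ((1152 * K ^ 4 * b) ^ i) := by
  intro i
  induction i with
  | zero => intro _; exact JetBound.const 1 (by simp)
  | succ i ih =>
    intro hi
    have hi' : i < n := by omega
    obtain ⟨hp, hpj⟩ := h.pivot_bounds hK hb hq hi'
    have hinv := hpj.inv hp
    rw [pow_succ]
    refine (ih hi'.le).mul (((((h.jetA i hi').mul (h.jetD i hi')).sub
      ((h.jetB i hi').mul (h.jetC i hi'))).mul (hinv.mul hinv)).mono (le_of_eq ?_))
    ring

lemma jet_rowRatio_step (h : FamilyBound A B C D K b n a) (hK : 2 ≤ K) (hb : 0 < b)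
    (hq : 1152 * K ^ 4 * b ≤ 1 / 4) {i : ℕ} (hi : i < n) :
    JetBound (fun t => B (i + 1) t * relDet A B C D i t * (pivot A B C D i t)⁻¹) a
      (24 * K ^ 2 * (1152 * K ^ 4 * b) ^ i) := by
  obtain ⟨hp, hpj⟩ := h.pivot_bounds hK hb hq hi
  exact (((h.jetB i hi).mul (h.jet_relDet hK hb hq i hi.le)).mul (hpj.inv hp)).mono
    (le_of_eq (by ring))

lemma jet_rowRatio_sub (h : FamilyBound A B C D K b n a) (hK : 2 ≤ K) (hb : 0 < b)
    (hq : 1152 * K ^ 4 * b ≤ 1 / 4) {i j : ℕ} (hij : i ≤ j) (hj : j ≤ n) :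
    JetBound (fun t => rowRatio A B C D j t - rowRatio A B C D i t) a
      (48 * K ^ 2 * (1152 * K ^ 4 * b) ^ i) := by
  have key : JetBound (fun t => rowRatio A B C D j t - rowRatio A B C D i t) a
      (48 * K ^ 2 * (1152 * K ^ 4 * b) ^ i - 48 * K ^ 2 * (1152 * K ^ 4 * b) ^ j) := by
    induction j, hij using Nat.le_induction with
    | base => simpa using JetBound.const (a := a) (c := 0) 0 (by simp)
    | succ j hij ih =>
      refine (((ih (by omega)).add (h.jet_rowRatio_step hK hb hq (i := j) (by omega))).mono
        ?_).congr (Filter.Eventually.of_forall fun t => ?_)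
      · have : K ^ 2 * (1152 * K ^ 4 * b) ^ j * (1152 * K ^ 4 * b) ≤
            K ^ 2 * (1152 * K ^ 4 * b) ^ j * (1 / 4) := by gcongr
        have : 0 ≤ K ^ 2 * (1152 * K ^ 4 * b) ^ j := by positivity
        rw [pow_succ (1152 * K ^ 4 * b)]
        linarith
      · simp only [rowRatio]; ring
  refine key.mono ?_
  have : 0 ≤ 48 * K ^ 2 * (1152 * K ^ 4 * b) ^ j := by positivity
  linarith

lemma jet_rowRatio (h : FamilyBound A B C D K b n a) (hK : 2 ≤ K) (hb : 0 < b)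
    (hq : 1152 * K ^ 4 * b ≤ 1 / 4) {i : ℕ} (hi : i ≤ n) :
    JetBound (rowRatio A B C D i) a (48 * K ^ 2) := by
  simpa [rowRatio] using h.jet_rowRatio_sub hK hb hq (Nat.zero_le i) hi

end FamilyBound

end Coordinates

section Direction

/-- The trace of `NᵀN` for `N = [[1, w], [σ, σ * w + ρ]]`. -/
noncomputable def gramTrace (w σ ρ : ℝ) : ℝ :=
  1 + σ * σ + w * w + (σ * w + ρ) * (σ * w + ρ)

/-- The small eigenvalue of `NᵀN`, divided by `ρ ^ 2`, for `N = [[1, w], [σ, σ * w + ρ]]`. -/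
noncomputable def eigenFactor (w σ ρ : ℝ) : ℝ :=
  2 * (gramTrace w σ ρ + √(gramTrace w σ ρ * gramTrace w σ ρ - 4 * (ρ * ρ)))⁻¹

/-- The vector `(ρ * kernelShift w σ ρ - w, 1)` is most contracted by
`[[1, w], [σ, σ * w + ρ]]`. -/
noncomputable def kernelShift (w σ ρ : ℝ) : ℝ :=
  (0 - (σ + w * (ρ * eigenFactor w σ ρ))) * (1 + σ * σ - ρ * ρ * eigenFactor w σ ρ)⁻¹

lemma one_le_gramTrace (w σ ρ : ℝ) : 1 ≤ gramTrace w σ ρ := by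
  unfold gramTrace; nlinarith [mul_self_nonneg σ, mul_self_nonneg w, mul_self_nonneg (σ * w + ρ)]

lemma quarter_le_gram_discr (w σ : ℝ) {ρ : ℝ} (hρ : |ρ| ≤ 1 / 4) :
    1 / 4 ≤ gramTrace w σ ρ * gramTrace w σ ρ - 4 * (ρ * ρ) := by
  have := one_le_gramTrace w σ ρ
  have := abs_le.1 hρ
  nlinarith

lemma eigenFactor_bounds (w σ ρ : ℝ) : 0 ≤ eigenFactor w σ ρ ∧ eigenFactor w σ ρ ≤ 2 := by
  have h1 := one_le_gramTrace w σ ρ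
  have h2 := Real.sqrt_nonneg (gramTrace w σ ρ * gramTrace w σ ρ - 4 * (ρ * ρ))
  unfold eigenFactor
  refine ⟨by positivity, ?_⟩
  have := inv_le_one_of_one_le₀ (show 1 ≤ gramTrace w σ ρ +
    √(gramTrace w σ ρ * gramTrace w σ ρ - 4 * (ρ * ρ)) by linarith)
  linarith

lemma half_le_gram_sub_eigen (w σ : ℝ) {ρ : ℝ} (hρ : |ρ| ≤ 1 / 4) :
    1 / 2 ≤ 1 + σ * σ - ρ * ρ * eigenFactor w σ ρ := by
  have := abs_le.1 hρ
  obtain ⟨h1, h2⟩ := eigenFactor_bounds w σ ρ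
  have : ρ * ρ ≤ 1 / 16 := by nlinarith
  have : ρ * ρ * eigenFactor w σ ρ ≤ 1 / 16 * 2 := by gcongr
  nlinarith [mul_self_nonneg σ]

lemma eigenFactor_quadratic (w σ : ℝ) {ρ : ℝ} (hρ : |ρ| ≤ 1 / 4) :
    ρ * ρ * eigenFactor w σ ρ ^ 2 - gramTrace w σ ρ * eigenFactor w σ ρ + 1 = 0 := by
  have h1 := one_le_gramTrace w σ ρ
  have h2 := Real.sqrt_nonneg (gramTrace w σ ρ * gramTrace w σ ρ - 4 * (ρ * ρ))
  have h3 := Real.mul_self_sqrt (show 0 ≤ gramTrace w σ ρ * gramTrace w σ ρ - 4 * (ρ * ρ) by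
    linarith [quarter_le_gram_discr w σ hρ])
  unfold eigenFactor
  set T := gramTrace w σ ρ
  set X := √(T * T - 4 * (ρ * ρ))
  have : T + X ≠ 0 := by linarith
  field_simp
  linarith

/-- The Gram form of `[[1, w], [σ, σ * w + ρ]]`, evaluated along the direction given by
`kernelShift`, is minimal among vectors of the same length. -/
lemma kernelShift_minimal (w σ : ℝ) {ρ : ℝ} (hρ : |ρ| ≤ 1 / 4) {g x y : ℝ}
    (hg : g ^ 2 * ((ρ * kernelShift w σ ρ - w) ^ 2 + 1) = 1) (hxy : x ^ 2 + y ^ 2 = 1) :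
    g ^ 2 * ((ρ * kernelShift w σ ρ) ^ 2 + (σ * (ρ * kernelShift w σ ρ) + ρ) ^ 2) ≤
      (x + w * y) ^ 2 + (σ * (x + w * y) + ρ * y) ^ 2 := by
  have hp := half_le_gram_sub_eigen w σ hρ
  have hq := eigenFactor_quadratic w σ hρ
  have hv : (1 + σ * σ - ρ * ρ * eigenFactor w σ ρ) * kernelShift w σ ρ =
      -(σ + w * (ρ * eigenFactor w σ ρ)) := by
    have h0 : 1 + σ * σ - ρ * ρ * eigenFactor w σ ρ ≠ 0 := by linarith
    rw [kernelShift, mul_left_comm, mul_inv_cancel₀ h0]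
    ring
  set k := eigenFactor w σ ρ
  set H := kernelShift w σ ρ
  simp only [gramTrace] at hq
  set m := 1 + σ * σ - ρ * ρ * k with hm
  have form : ∀ x y : ℝ, m * ((x + w * y) ^ 2 + (σ * (x + w * y) + ρ * y) ^ 2 -
      ρ * ρ * k * (x ^ 2 + y ^ 2)) = (m * x + (w * (1 + σ * σ) + σ * ρ) * y) ^ 2 := by
    intro x y
    rw [hm]
    linear_combination (ρ * ρ * y ^ 2) * hq
  have hker := form (ρ * H - w) 1
  have hz : m * (ρ * H - w) + (w * (1 + σ * σ) + σ * ρ) * 1 = 0 := by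
    linear_combination ρ * hv - w * hm
  rw [hz] at hker
  have hker' : (ρ * H) ^ 2 + (σ * (ρ * H) + ρ) ^ 2 = ρ * ρ * k * ((ρ * H - w) ^ 2 + 1) := by
    have : m ≠ 0 := by linarith
    have h0 := (mul_eq_zero.1 (hker.trans (by ring))).resolve_left this
    linear_combination h0
  have hx := form x y
  rw [hxy] at hx
  rw [hker', show g ^ 2 * (ρ * ρ * k * ((ρ * H - w) ^ 2 + 1)) =
    ρ * ρ * k * (g ^ 2 * ((ρ * H - w) ^ 2 + 1)) by ring, hg]
  by_contra! hlt
  nlinarith [sq_nonneg (m * x + (w * (1 + σ * σ) + σ * ρ) * y)]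

lemma jetBound_kernelShift {w σ ρ : ℝ → ℝ} {a W : ℝ} (hW : 1 ≤ W) (hw : JetBound w a W)
    (hσ : JetBound σ a 1) (hρ : JetBound ρ a (1 / 4)) :
    JetBound (fun t => kernelShift (w t) (σ t) (ρ t)) a (3300000 * W ^ 9) := by
  have hρa : |ρ a| ≤ 1 / 4 := hρ.norm_le
  have hρ1 : JetBound ρ a 1 := hρ.mono (by norm_num)
  have one : JetBound (fun _ : ℝ => (1 : ℝ)) a 1 := .const 1 (by simp)
  have p2 : 1 ≤ W ^ 2 := one_le_pow₀ hW
  have p4 : W ^ 2 ≤ W ^ 4 := pow_le_pow_right₀ hW (by norm_num)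
  have p9 : W ^ 4 ≤ W ^ 9 := pow_le_pow_right₀ hW (by norm_num)
  have hT : JetBound (fun t => gramTrace (w t) (σ t) (ρ t)) a (7 * W ^ 2) :=
    (((one.add (hσ.mul hσ)).add (hw.mul hw)).add
      (((hσ.mul hw).add hρ1).mul ((hσ.mul hw).add hρ1))).mono (by nlinarith)
  have hdisc := (hT.mul hT).sub ((JetBound.const (a := a) (c := 4) 4 (by simp)).mul
    (hρ1.mul hρ1))
  have hX := hdisc.sqrt (quarter_le_gram_discr (w a) (σ a) hρa)
  have hY := (hT.add hX).inv (by
    have h1 := one_le_gramTrace (w a) (σ a) (ρ a)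
    have h2 := Real.sqrt_nonneg (gramTrace (w a) (σ a) (ρ a) * gramTrace (w a) (σ a) (ρ a) -
      4 * (ρ a * ρ a))
    exact le_abs.2 (Or.inl (by linarith)))
  have hk : JetBound (fun t => eigenFactor (w t) (σ t) (ρ t)) a (904 * W ^ 4) :=
    ((JetBound.const (a := a) (c := 2) 2 (by simp)).mul hY).mono (by nlinarith)
  have hden := ((one.add (hσ.mul hσ)).sub ((hρ1.mul hρ1).mul hk)).inv
    ((half_le_gram_sub_eigen (w a) (σ a) hρa).trans (le_abs_self _))
  refine (((JetBound.const (a := a) (c := 0) 0 (by simp)).sub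
    (hσ.add (hw.mul (hρ1.mul hk)))).mul hden).mono ?_
  have p5 : W ^ 5 ≤ W ^ 9 := pow_le_pow_right₀ hW (by norm_num)
  ring_nf
  linarith

end Direction

section UnitVector

lemma jetBound_invSqrt {u : ℝ → ℝ} {a U : ℝ} (hu : JetBound u a U) :
    JetBound (fun t => √(1 + u t * u t)) a (2 * (1 + U * U)) ∧
      JetBound (fun t => (√(1 + u t * u t))⁻¹) a (8 * (1 + U * U)) := by
  have h := (JetBound.const (a := a) (c := 1) 1 (by simp)).add (hu.mul hu)
  have hs := h.sqrt (by nlinarith [mul_self_nonneg (u a)])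
  refine ⟨hs, (hs.inv ?_).mono (by linarith)⟩
  refine le_trans ?_ (le_abs_self _)
  exact Real.le_sqrt_of_sq_le (by nlinarith [mul_self_nonneg (u a)])

lemma jetBound_invSqrt_sub {u v : ℝ → ℝ} {a U G ε : ℝ} (hu : JetBound u a U)
    (hv : JetBound v a U) (huv : JetBound (fun t => u t - v t) a ε) (hG : G = 8 * (1 + U * U)) :
    JetBound (fun t => (√(1 + u t * u t))⁻¹ - (√(1 + v t * v t))⁻¹) a
      (4 * U * G ^ 3 * ε) := by
  obtain ⟨su, gu⟩ := jetBound_invSqrt hu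
  obtain ⟨sv, gv⟩ := jetBound_invSqrt hv
  have pos : ∀ x : ℝ, 1 ≤ √(1 + x * x) := fun x =>
    Real.le_sqrt_of_sq_le (by nlinarith [mul_self_nonneg x])
  have hsum := (su.add sv).inv ((by linarith [pos (u a), pos (v a)] :
    1 / 2 ≤ √(1 + u a * u a) + √(1 + v a * v a)).trans (le_abs_self _))
  have hfin := (JetBound.const (a := a) (c := 0) 0 (by simp)).sub
    (((huv.mul (hu.add hv)).mul (gu.mul gv)).mul hsum)
  refine (hfin.mono (le_of_eq ?_)).congr (Filter.Eventually.of_forall fun t => ?_)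
  · rw [hG]; ring
  · have h1 := pos (u t)
    have h2 := pos (v t)
    have e1 := Real.sq_sqrt (show 0 ≤ 1 + u t * u t by nlinarith [mul_self_nonneg (u t)])
    have e2 := Real.sq_sqrt (show 0 ≤ 1 + v t * v t by nlinarith [mul_self_nonneg (v t)])
    have n1 : √(1 + u t * u t) ≠ 0 := by linarith
    have n2 : √(1 + v t * v t) ≠ 0 := by linarith
    have n3 : √(1 + u t * u t) + √(1 + v t * v t) ≠ 0 := by linarith
    simp only
    generalize √(1 + u t * u t) = x at *
    generalize √(1 + v t * v t) = y at *
    field_simp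
    linear_combination e2 - e1

lemma jetBound_vec {x y : ℝ → ℝ} {a c d : ℝ} (hx : JetBound x a c) (hy : JetBound y a d) :
    JetBound (fun t => !₂[x t, y t]) a (c + d) := by
  refine ((hx.smul_const (v := EuclideanSpace.single (0 : Fin 2) (1 : ℝ)) (by simp)).add
    (hy.smul_const (v := EuclideanSpace.single (1 : Fin 2) (1 : ℝ)) (by simp))).congr
    (Filter.Eventually.of_forall fun t => ?_)
  ext j
  fin_cases j <;> simp

lemma norm_sq_vec (x y : ℝ) : ‖!₂[x, y]‖ ^ 2 = x ^ 2 + y ^ 2 := by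
  simp [EuclideanSpace.norm_sq_eq]

lemma toEuclideanLin_vec (p q r s x y : ℝ) :
    Matrix.toEuclideanLin !![p, q; r, s] !₂[x, y] = !₂[p * x + q * y, r * x + s * y] := by
  ext j
  fin_cases j <;> simp [Matrix.toEuclideanLin] <;> ring

end UnitVector

section ContractedDirection

variable (A B C D : ℕ → ℝ → ℝ)

/-- The displacement from `- rowRatio` of the slope of the most contracted direction. -/
noncomputable def dirShift (i : ℕ) (t : ℝ) : ℝ :=
  relDet A B C D i t *
    kernelShift (rowRatio A B C D i t) (imageSlope A B C D i t) (relDet A B C D i t)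

/-- The most contracted direction of the product of the first `i` matrices is spanned by
`(dirSlope i, 1)`. -/
noncomputable def dirSlope (i : ℕ) (t : ℝ) : ℝ :=
  dirShift A B C D i t - rowRatio A B C D i t

/-- The normalizing factor of `(dirSlope i, 1)`. -/
noncomputable def dirScale (i : ℕ) (t : ℝ) : ℝ :=
  (√(1 + dirSlope A B C D i t * dirSlope A B C D i t))⁻¹

/-- The most contracted unit direction of the product of the first `i` matrices. -/
noncomputable def contractedDir (i : ℕ) (t : ℝ) : EuclideanSpace ℝ (Fin 2) :=
  !₂[dirSlope A B C D i t * dirScale A B C D i t, dirScale A B C D i t]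

lemma dirScale_sq (i : ℕ) (t : ℝ) :
    dirScale A B C D i t ^ 2 * (dirSlope A B C D i t ^ 2 + 1) = 1 := by
  have h : 0 < 1 + dirSlope A B C D i t * dirSlope A B C D i t := by
    nlinarith [mul_self_nonneg (dirSlope A B C D i t)]
  rw [dirScale, inv_pow, Real.sq_sqrt h.le]
  field_simp
  ring

lemma norm_contractedDir (i : ℕ) (t : ℝ) : ‖contractedDir A B C D i t‖ = 1 := by
  rw [← sq_eq_sq₀ (norm_nonneg _) zero_le_one, contractedDir, norm_sq_vec]
  linear_combination dirScale_sq A B C D i t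

/-- The product of the first `i` matrices in terms of its coordinates. -/
noncomputable def productMatrix (i : ℕ) (t : ℝ) : Matrix (Fin 2) (Fin 2) ℝ :=
  !![corner A B C D i t, corner A B C D i t * rowRatio A B C D i t;
    corner A B C D i t * imageSlope A B C D i t,
    corner A B C D i t *
      (imageSlope A B C D i t * rowRatio A B C D i t + relDet A B C D i t)]

lemma productMatrix_one (t : ℝ) (h : pivot A B C D 0 t ≠ 0) :
    productMatrix A B C D 1 t = !![A 1 t, B 1 t; C 1 t, D 1 t] := by
  have h' : A 1 t ≠ 0 := by simpa [pivot, imageSlope] using h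
  ext i j
  fin_cases i <;> fin_cases j <;>
    simp [productMatrix, corner, rowRatio, imageSlope, relDet, pivot] <;> field_simp
  ring

lemma productMatrix_succ (i : ℕ) (t : ℝ) (h : pivot A B C D i t ≠ 0) :
    productMatrix A B C D (i + 1) t =
      !![A (i + 1) t, B (i + 1) t; C (i + 1) t, D (i + 1) t] * productMatrix A B C D i t := by
  have hp : pivot A B C D i t = A (i + 1) t + B (i + 1) t * imageSlope A B C D i t := rfl
  have hs : imageSlope A B C D (i + 1) t =
    (C (i + 1) t + D (i + 1) t * imageSlope A B C D i t) * (pivot A B C D i t)⁻¹ := rfl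
  rw [productMatrix, productMatrix, Matrix.mul_fin_two, hs]
  simp only [corner, rowRatio, relDet]
  generalize pivot A B C D i t = f at *
  subst hp
  congr 1
  ext i' j
  fin_cases i' <;> fin_cases j <;> simp <;> field_simp <;> ring

variable {A B C D} in
lemma productMatrix_contractedDir_le {i : ℕ} {t : ℝ} (hρ : |relDet A B C D i t| ≤ 1 / 4)
    {x : EuclideanSpace ℝ (Fin 2)} (hx : ‖x‖ = 1) :
    ‖Matrix.toEuclideanLin (productMatrix A B C D i t) (contractedDir A B C D i t)‖ ≤
      ‖Matrix.toEuclideanLin (productMatrix A B C D i t) x‖ := by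
  obtain ⟨x0, x1, rfl⟩ : ∃ x0 x1 : ℝ, x = !₂[x0, x1] :=
    ⟨x 0, x 1, by ext j; fin_cases j <;> simp⟩
  have hxy : x0 ^ 2 + x1 ^ 2 = 1 := by rw [← norm_sq_vec, hx]; norm_num
  have key := kernelShift_minimal (rowRatio A B C D i t) (imageSlope A B C D i t) hρ
    (dirScale_sq A B C D i t) hxy
  refine le_of_sq_le_sq ?_ (norm_nonneg _)
  rw [productMatrix, contractedDir, toEuclideanLin_vec, toEuclideanLin_vec, norm_sq_vec,
    norm_sq_vec]
  have key' := mul_le_mul_of_nonneg_left key (sq_nonneg (corner A B C D i t))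
  refine (le_of_eq ?_).trans (key'.trans (le_of_eq ?_))
  · rw [dirSlope, dirShift]; ring
  · ring

namespace FamilyBound

variable {A B C D} {K b a H U G : ℝ} {n : ℕ}

lemma pow_le_quarter (hb : 0 < b) (hq : 1152 * K ^ 4 * b ≤ 1 / 4) {i : ℕ} (hi : 1 ≤ i) :
    (1152 * K ^ 4 * b) ^ i ≤ 1 / 4 :=
  (pow_le_of_le_one (by positivity) (by linarith) (by omega)).trans hq

lemma jet_dirShift (h : FamilyBound A B C D K b n a) (hK : 2 ≤ K) (hb : 0 < b)
    (hq : 1152 * K ^ 4 * b ≤ 1 / 4) (hH : H = 3300000 * (48 * K ^ 2) ^ 9)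
    {i : ℕ} (h1 : 1 ≤ i) (hi : i ≤ n) :
    JetBound (dirShift A B C D i) a (H * (1152 * K ^ 4 * b) ^ i) := by
  have hρ := h.jet_relDet hK hb hq i hi
  have := jetBound_kernelShift (by nlinarith) (h.jet_rowRatio hK hb hq hi)
    (h.jet_slope_one hK hb hq hi) (hρ.mono (pow_le_quarter hb hq h1))
  exact (hρ.mul this).mono (le_of_eq (by rw [hH]; ring))

lemma jet_dirSlope (h : FamilyBound A B C D K b n a) (hK : 2 ≤ K) (hb : 0 < b)
    (hq : 1152 * K ^ 4 * b ≤ 1 / 4) (hH : H = 3300000 * (48 * K ^ 2) ^ 9)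
    (hU : U = H + 48 * K ^ 2) {i : ℕ} (h1 : 1 ≤ i) (hi : i ≤ n) :
    JetBound (dirSlope A B C D i) a U := by
  have hH0 : 0 < H := by rw [hH]; positivity
  have := pow_le_quarter hb hq h1
  exact ((h.jet_dirShift hK hb hq hH h1 hi).sub (h.jet_rowRatio hK hb hq hi)).mono
    (by rw [hU]; nlinarith)

lemma jet_dirSlope_sub (h : FamilyBound A B C D K b n a) (hK : 2 ≤ K) (hb : 0 < b)
    (hq : 1152 * K ^ 4 * b ≤ 1 / 4) (hH : H = 3300000 * (48 * K ^ 2) ^ 9)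
    (hU : U = H + 48 * K ^ 2) {i : ℕ} (h1 : 1 ≤ i) (hi : i < n) :
    JetBound (fun t => dirSlope A B C D (i + 1) t - dirSlope A B C D i t) a
      (2 * U * (1152 * K ^ 4 * b) ^ i) := by
  have hH0 : 0 < H := by rw [hH]; positivity
  have hpos : 0 ≤ (1152 * K ^ 4 * b) ^ i := by positivity
  have hle : (1152 * K ^ 4 * b) ^ (i + 1) ≤ (1152 * K ^ 4 * b) ^ i :=
    pow_le_pow_of_le_one (by positivity) (by linarith) (by omega)
  refine (((h.jet_dirShift hK hb hq hH (i := i + 1) (by omega) hi).sub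
    (h.jet_dirShift hK hb hq hH h1 hi.le)).sub
    (h.jet_rowRatio_sub hK hb hq (i := i) (j := i + 1) (by omega) hi)).mono ?_ |>.congr
    (Filter.Eventually.of_forall fun t => ?_)
  · have := mul_le_mul_of_nonneg_left hle hH0.le
    have : 0 ≤ 48 * K ^ 2 * (1152 * K ^ 4 * b) ^ i := by positivity
    rw [hU]
    linarith
  · simp only [dirSlope]; ring

lemma jet_contractedDir (h : FamilyBound A B C D K b n a) (hK : 2 ≤ K) (hb : 0 < b)
    (hq : 1152 * K ^ 4 * b ≤ 1 / 4) (hH : H = 3300000 * (48 * K ^ 2) ^ 9)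
    (hU : U = H + 48 * K ^ 2) (hG : G = 8 * (1 + U * U)) {i : ℕ} (h1 : 1 ≤ i) (hi : i ≤ n) :
    JetBound (contractedDir A B C D i) a (U * G + G) := by
  have hu := h.jet_dirSlope hK hb hq hH hU h1 hi
  have hg := hG ▸ (jetBound_invSqrt hu).2
  exact jetBound_vec (hu.mul hg) hg

lemma jet_contractedDir_sub (h : FamilyBound A B C D K b n a) (hK : 2 ≤ K) (hb : 0 < b)
    (hq : 1152 * K ^ 4 * b ≤ 1 / 4) (hH : H = 3300000 * (48 * K ^ 2) ^ 9)
    (hU : U = H + 48 * K ^ 2) (hG : G = 8 * (1 + U * U)) {i : ℕ} (h1 : 1 ≤ i) (hi : i < n) :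
    JetBound (fun t => contractedDir A B C D (i + 1) t - contractedDir A B C D i t) a
      (18 * U ^ 3 * G ^ 3 * (1152 * K ^ 4 * b) ^ i) := by
  have hH0 : 0 < H := by rw [hH]; positivity
  have hU1 : 1 ≤ U := by nlinarith
  have hG1 : 1 ≤ G := by nlinarith
  have hpos : 0 ≤ (1152 * K ^ 4 * b) ^ i := by positivity
  have hu := h.jet_dirSlope hK hb hq hH hU h1 hi.le
  have hv := h.jet_dirSlope hK hb hq hH hU (i := i + 1) (by omega) hi
  have huv := h.jet_dirSlope_sub hK hb hq hH hU h1 hi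
  have hg := hG ▸ (jetBound_invSqrt hv).2
  have hd := jetBound_invSqrt_sub hv hu huv hG
  refine ((jetBound_vec ((huv.mul hg).add (hu.mul hd)) hd).mono ?_).congr
    (Filter.Eventually.of_forall fun t => ?_)
  · have e1 : U * G ≤ U ^ 3 * G ^ 3 := by
      gcongr
      · exact le_self_pow₀ hU1 (by norm_num)
      · exact le_self_pow₀ hG1 (by norm_num)
    have e2 : U ^ 2 * G ^ 3 ≤ U ^ 3 * G ^ 3 := by
      gcongr
      norm_num
    have := mul_le_mul_of_nonneg_right e1 hpos
    have := mul_le_mul_of_nonneg_right e2 hpos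
    linarith
  · simp only [contractedDir, dirScale]
    ext j
    fin_cases j <;> simp
    ring

lemma jet_productMatrix_contractedDir (h : FamilyBound A B C D K b n a) (hK : 2 ≤ K)
    (hb : 0 < b) (hq : 1152 * K ^ 4 * b ≤ 1 / 4) (hH : H = 3300000 * (48 * K ^ 2) ^ 9)
    (hU : U = H + 48 * K ^ 2) (hG : G = 8 * (1 + U * U)) {i : ℕ} (h1 : 1 ≤ i) (hi : i ≤ n) :
    JetBound (fun t => Matrix.toEuclideanLin (productMatrix A B C D i t)
      (contractedDir A B C D n t)) a (3 * U * G * (3 * K * (1152 * K ^ 4 * b)) ^ i) := by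
  have hH0 : 0 < H := by rw [hH]; positivity
  have hU1 : 1 ≤ U := by nlinarith
  have hG1 : 1 ≤ G := by nlinarith
  have hpos : 0 ≤ (1152 * K ^ 4 * b) ^ i := by positivity
  have hle : (1152 * K ^ 4 * b) ^ n ≤ (1152 * K ^ 4 * b) ^ i :=
    pow_le_pow_of_le_one (by positivity) (by linarith) hi
  have hu := h.jet_dirSlope hK hb hq hH hU (h1.trans hi) le_rfl
  have hg := hG ▸ (jetBound_invSqrt hu).2
  have hz := ((h.jet_dirShift hK hb hq hH (h1.trans hi) le_rfl).sub
    (h.jet_rowRatio_sub hK hb hq hi le_rfl)).mono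
    (show _ ≤ U * (1152 * K ^ 4 * b) ^ i by
      have := mul_le_mul_of_nonneg_left hle hH0.le
      rw [hU]; linarith)
  have hαg := (h.jet_corner hK hb hq i hi).mul hg
  have hρ := h.jet_relDet hK hb hq i hi
  have hσ := h.jet_slope_one hK hb hq hi
  refine ((jetBound_vec (hαg.mul hz) (hαg.mul ((hσ.mul hz).add hρ))).mono ?_).congr
    (Filter.Eventually.of_forall fun t => ?_)
  · rw [mul_pow (3 * K)]
    have : 0 ≤ (3 * K) ^ i * G * (1152 * K ^ 4 * b) ^ i := by positivity
    nlinarith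
  · simp only [productMatrix, contractedDir]
    rw [toEuclideanLin_vec]
    ext j
    fin_cases j <;> simp [dirScale, dirSlope] <;> ring

end FamilyBound

end ContractedDirection

lemma mul_pow_le_mul_pow {d x : ℝ} (hd : 1 ≤ d) (hx : 0 ≤ x) {i : ℕ} (hi : 1 ≤ i) :
    d * x ^ i ≤ (d * x) ^ i := by
  rw [mul_pow]
  gcongr
  exact le_self_pow₀ hd (by omega)

/-- C¹ parameter dependence of the most contracted directions of products of
parameter-dependent expanding matrices with small determinant. -/
theorem stmt16 (K : ℝ) (hK : 2 ≤ K) :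
    ∃ C : ℝ, 0 < C ∧
    ∀ (b : ℝ), 0 < b → C * b ≤ 1/2 →
    ∀ (l r : ℝ) (J : Set ℝ), J = Set.Ioo l r →
    ∀ (n : ℕ), 1 ≤ n →
    ∀ (mA mB mC mD mA' mB' mC' mD' : ℕ → ℝ → ℝ),
    (∀ i, 1 ≤ i → i ≤ n → ∀ a ∈ J,
      HasDerivAt (mA i) (mA' i a) a ∧ HasDerivAt (mB i) (mB' i a) a ∧
      HasDerivAt (mC i) (mC' i a) a ∧ HasDerivAt (mD i) (mD' i a) a) →
    (∀ i, 1 ≤ i → i ≤ n → ∀ a ∈ J,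
      2 ≤ |mA i a| ∧ |mA i a| ≤ K ∧ |mB i a| ≤ K ∧
      |mC i a| ≤ K * b ∧ |mD i a| ≤ K * b ∧
      |mA' i a| ≤ K ∧ |mB' i a| ≤ K ∧ |mC' i a| ≤ K * b ∧ |mD' i a| ≤ K * b) →
    ∀ (M : ℕ → ℝ → Matrix (Fin 2) (Fin 2) ℝ),
    (∀ i a, M i a = Matrix.of ![![mA i a, mB i a], ![mC i a, mD i a]]) →
    ∀ (P : ℕ → ℝ → Matrix (Fin 2) (Fin 2) ℝ),
    (∀ a, P 1 a = M 1 a) → (∀ i a, P (i + 1) a = M (i + 1) a * P i a) →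
    (∀ i, 1 ≤ i → i ≤ n → ∀ a ∈ J, ∃ x : EuclideanSpace ℝ (Fin 2),
      ‖x‖ = 1 ∧ 1 ≤ ‖Matrix.toEuclideanLin (P i a) x‖) →
    ∃ e e' : ℕ → ℝ → EuclideanSpace ℝ (Fin 2),
      (∀ i, 1 ≤ i → i ≤ n → ∀ a ∈ J,
        ‖e i a‖ = 1 ∧
        (∀ x : EuclideanSpace ℝ (Fin 2), ‖x‖ = 1 →
          ‖Matrix.toEuclideanLin (P i a) (e i a)‖ ≤ ‖Matrix.toEuclideanLin (P i a) x‖) ∧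
        HasDerivAt (fun t => e i t) (e' i a) a ∧ ‖e' i a‖ ≤ C) ∧
      (∀ i, 1 ≤ i → i < n → ∀ a ∈ J, ‖e' (i + 1) a - e' i a‖ ≤ (C * b) ^ i) ∧
      (∀ i, 1 ≤ i → i ≤ n → ∀ a ∈ J, ∃ g : EuclideanSpace ℝ (Fin 2),
        HasDerivAt (fun t => Matrix.toEuclideanLin (P i t) (e n t)) g a ∧
        ‖g‖ ≤ (C * b) ^ i) := by
  obtain ⟨H, hH⟩ : ∃ H : ℝ, H = 3300000 * (48 * K ^ 2) ^ 9 := ⟨_, rfl⟩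
  obtain ⟨U, hU⟩ : ∃ U : ℝ, U = H + 48 * K ^ 2 := ⟨_, rfl⟩
  obtain ⟨G, hG⟩ : ∃ G : ℝ, G = 8 * (1 + U * U) := ⟨_, rfl⟩
  have hH0 : 0 < H := by rw [hH]; positivity
  have hU1 : 1 ≤ U := by nlinarith
  have hG1 : 1 ≤ G := by nlinarith
  have hUG : 1 ≤ U * G := one_le_mul_of_one_le_of_one_le hU1 hG1
  obtain ⟨L, hL⟩ : ∃ L : ℝ, L = 18 * U ^ 3 * G ^ 3 := ⟨_, rfl⟩
  have hUGL : 3 * U * G ≤ L := by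
    have : U * G ≤ (U * G) ^ 3 := le_self_pow₀ hUG (by norm_num)
    rw [hL]; nlinarith [mul_pow U G 3]
  have hL1 : 3 ≤ L := by nlinarith
  have hK4 : 16 ≤ K ^ 4 := by
    calc (16 : ℝ) = 2 ^ 4 := by norm_num
      _ ≤ K ^ 4 := by gcongr
  refine ⟨L * (3 * K * (1152 * K ^ 4)), by positivity, ?_⟩
  intro b hb hCb l r J hJ n hn mA mB mC mD mA' mB' mC' mD' hder hbd M hM P hP1 hPs _
  have hCb' : L * (3 * K * (1152 * K ^ 4)) * b = L * (3 * K * (1152 * K ^ 4 * b)) := by ring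
  rw [hCb'] at hCb ⊢
  have hq0 : 0 < 1152 * K ^ 4 * b := by positivity
  have hq : 1152 * K ^ 4 * b ≤ 1 / 4 := by
    have : 18 * (1152 * K ^ 4 * b) ≤ L * (3 * K * (1152 * K ^ 4 * b)) := by
      rw [← mul_assoc L]
      gcongr
      nlinarith
    linarith
  have hfam : ∀ a ∈ J, FamilyBound mA mB mC mD K b n a := by
    intro a ha
    have jet : ∀ {f f' : ℝ → ℝ} {c : ℝ}, HasDerivAt f (f' a) a → |f a| ≤ c → |f' a| ≤ c →
        JetBound f a (2 * c) := fun hf h1 h2 =>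
      ⟨hf.differentiableAt, by rw [hf.deriv, Real.norm_eq_abs, Real.norm_eq_abs]; linarith⟩
    constructor
    · intro i hi; exact (hbd (i + 1) (by omega) hi a ha).1
    all_goals
      intro i hi
      obtain ⟨d1, d2, d3, d4⟩ := hder (i + 1) (by omega) hi a ha
      obtain ⟨-, b1, b2, b3, b4, b5, b6, b7, b8⟩ := hbd (i + 1) (by omega) hi a ha
    · exact jet d1 b1 b5
    · exact jet d2 b2 b6
    · exact mul_assoc 2 K b ▸ jet d3 b3 b7
    · exact mul_assoc 2 K b ▸ jet d4 b4 b8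
  have hP : ∀ i, 1 ≤ i → i ≤ n → ∀ a ∈ J, P i a = productMatrix mA mB mC mD i a := by
    intro i hi
    have hpiv : ∀ j < n, ∀ a ∈ J, pivot mA mB mC mD j a ≠ 0 := by
      intro j hj a ha h0
      have := ((hfam a ha).pivot_bounds hK hb hq hj).1
      rw [h0] at this
      norm_num at this
    induction i, hi using Nat.le_induction with
    | base =>
      intro hin a ha
      rw [hP1, hM, productMatrix_one _ _ _ _ _ (hpiv 0 hin a ha)]
    | succ i hi ih =>
      intro hin a ha
      rw [hPs, hM, ih (by omega) a ha, productMatrix_succ _ _ _ _ _ _ (hpiv i hin a ha)]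
  have hdir : ∀ i, 1 ≤ i → i ≤ n → ∀ a ∈ J,
      JetBound (contractedDir mA mB mC mD i) a (U * G + G) := fun i h1 hi a ha =>
    (hfam a ha).jet_contractedDir hK hb hq hH hU hG h1 hi
  have hpow : ∀ i, 1 ≤ i → L * (3 * K * (1152 * K ^ 4 * b)) ^ i ≤
      (L * (3 * K * (1152 * K ^ 4 * b))) ^ i := fun i hi =>
    mul_pow_le_mul_pow (by linarith) (by positivity) hi
  refine ⟨contractedDir mA mB mC mD, fun i => deriv (contractedDir mA mB mC mD i), ?_, ?_, ?_⟩
  · intro i h1 hi a ha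
    have hj := hdir i h1 hi a ha
    refine ⟨norm_contractedDir _ _ _ _ _ _, fun x hx => ?_, hj.1.hasDerivAt,
      hj.norm_deriv_le.trans ?_⟩
    · rw [hP i h1 hi a ha]
      have hρ := (((hfam a ha).jet_relDet hK hb hq i hi).mono
        (FamilyBound.pow_le_quarter hb hq h1)).norm_le
      exact productMatrix_contractedDir_le hρ hx
    · have e1 : U * G + G ≤ L := by nlinarith
      have e2 : 1 ≤ 3 * K * (1152 * K ^ 4) := by nlinarith
      nlinarith
  · intro i h1 hi a ha
    have hj := (hfam a ha).jet_contractedDir_sub hK hb hq hH hU hG h1 hi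
    rw [← hL] at hj
    have hd := ((hdir (i + 1) (by omega) hi a ha).1.hasDerivAt.fun_sub
      (hdir i h1 hi.le a ha).1.hasDerivAt).deriv
    have hn := hj.norm_deriv_le
    rw [hd] at hn
    refine hn.trans (le_trans ?_ (hpow i h1))
    have : 1152 * K ^ 4 * b ≤ 3 * K * (1152 * K ^ 4 * b) :=
      le_mul_of_one_le_left hq0.le (by linarith)
    gcongr
  · intro i h1 hi a ha
    have hj := (hfam a ha).jet_productMatrix_contractedDir hK hb hq hH hU hG h1 hi
    have hnhds : J ∈ nhds a := by
      rw [hJ] at ha ⊢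
      exact isOpen_Ioo.mem_nhds ha
    have hj' : JetBound (fun t => Matrix.toEuclideanLin (P i t) (contractedDir mA mB mC mD n t))
        a _ := hj.congr (by filter_upwards [hnhds] with t ht; rw [hP i h1 hi t ht])
    refine ⟨_, hj'.1.hasDerivAt, hj'.norm_deriv_le.trans (le_trans ?_ (hpow i h1))⟩
    gcongr
end

section
/- Assume in addition that E(θ + 2π, z) = E(θ, z) for all (θ, z), so that F and T induce a map of the annulus 𝒜 = (ℝ/2πℤ) × [−1,1] defined on V ⊂ 𝒜. Let V_f = {(θ,z) ∈ V : |1 − d·F_θ(θ,z)/F(θ,z)| < 2} (the fold region), and suppose that F(T(p)) < 0 for every p ∈ V_f (i.e. the image of the fold region lies in the escape strip U = {F < 0}). Let Λ be the set of points p ∈ V admitting a bi-infinite orbit, i.e. a sequence (p_i)_{i ∈ ℤ} with p₀ = p, p_i ∈ V and T(p_i) = p_{i+1} for all i ∈ ℤ. Then T restricted to Λ is topologically conjugate to the full two-sided shift on countably many symbols: there is a homeomorphism h from ℕ^ℤ (with the product topology) onto Λ such that T ∘ h = h ∘ σ, where σ is the left shift on ℕ^ℤ. -/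
section

open Set Filter Topology
open scoped BoundedContinuousFunction NNReal

/-- A closed family of real fibres over a connected base, uniformly bounded, in which every point
persists and is locally unique, is a finite disjoint union of graphs of continuous functions. -/
theorem exists_sheets {P : Type*} [TopologicalSpace P] [PreconnectedSpace P] [Nonempty P]
    {A B : ℝ} (S : Set (P × ℝ)) (hS : IsClosed S)
    (hb : ∀ q ∈ S, q.2 ∈ Icc A B)
    (huniq : ∀ q ∈ S, ∃ ε > 0, ∀ᶠ x in 𝓝 q.1, ∀ y y', |y - q.2| < ε → |y' - q.2| < ε →
      (x, y) ∈ S → (x, y') ∈ S → y = y')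
    (hper : ∀ q ∈ S, ∀ ε > 0, ∀ᶠ x in 𝓝 q.1, ∃ y, |y - q.2| < ε ∧ (x, y) ∈ S) :
    ∃ (N : ℕ) (f : Fin N → P → ℝ), (∀ j, Continuous (f j)) ∧
      (∀ x y, (x, y) ∈ S ↔ ∃ j, f j x = y) ∧ ∀ x, Function.Injective fun j => f j x := by
  obtain ⟨x₀⟩ := ‹Nonempty P›
  have hfin : ∀ S : Set (P × ℝ), IsClosed S → (∀ q ∈ S, q.2 ∈ Icc A B) →
      (∀ q ∈ S, ∃ ε > 0, ∀ᶠ x in 𝓝 q.1, ∀ y y', |y - q.2| < ε → |y' - q.2| < ε →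
        (x, y) ∈ S → (x, y') ∈ S → y = y') → {y | (x₀, y) ∈ S}.Finite := by
    intro S hS hb huniq
    have hcl : IsClosed {y | (x₀, y) ∈ S} := hS.preimage (by fun_prop)
    have hc : IsCompact {y | (x₀, y) ∈ S} :=
      isCompact_Icc.of_isClosed_subset hcl fun y hy => hb _ hy
    refine hc.finite (isDiscrete_iff_forall_mem_exists_isOpen.2 ?_)
    intro y hy
    obtain ⟨ε, hε, h⟩ := huniq _ hy
    refine ⟨Metric.ball y ε, Metric.isOpen_ball, ?_⟩
    ext y'
    simp only [mem_inter_iff, Metric.mem_ball, mem_ofPred_eq, mem_singleton_iff, Real.dist_eq]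
    constructor
    · rintro ⟨h1, h2⟩
      exact h.self_of_nhds _ _ h1 (by simpa using hε) h2 hy
    · rintro rfl
      exact ⟨by simpa using hε, hy⟩
  induction hn : {y | (x₀, y) ∈ S}.ncard using Nat.strong_induction_on generalizing S with
  | _ n ih =>
  subst hn
  set D : Set P := {x | ∃ y, (x, y) ∈ S} with hD
  have hDo : IsOpen D := isOpen_iff_mem_nhds.2 fun x ⟨y, hy⟩ => by
    filter_upwards [hper _ hy 1 one_pos] with x' ⟨y', _, h⟩ using ⟨y', h⟩
  have hDc : IsClosed D := by
    have h2 : D = Prod.fst '' ((fun p : P × Icc A B => (p.1, (p.2 : ℝ))) ⁻¹' S) := by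
      ext x
      constructor
      · rintro ⟨y, hy⟩
        exact ⟨(x, ⟨y, hb _ hy⟩), hy, rfl⟩
      · rintro ⟨⟨x', y⟩, hy, rfl⟩
        exact ⟨y, hy⟩
    rw [h2]
    exact isClosedMap_fst_of_compactSpace _ (hS.preimage (by fun_prop))
  rcases isClopen_iff.1 ⟨hDc, hDo⟩ with hemp | hall
  · refine ⟨0, Fin.elim0, fun j => j.elim0, fun x y => ⟨fun h => ?_, fun ⟨j, _⟩ => j.elim0⟩,
      fun x j => j.elim0⟩
    have : x ∈ D := ⟨y, h⟩
    simp [hemp] at this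
  have hne : ∀ x, {y | (x, y) ∈ S}.Nonempty := fun x => (hall ▸ mem_univ x : x ∈ D)
  have hmin : ∀ x, ∃ y, (x, y) ∈ S ∧ ∀ y', (x, y') ∈ S → y ≤ y' := by
    intro x
    have hc : IsCompact {y | (x, y) ∈ S} :=
      isCompact_Icc.of_isClosed_subset (hS.preimage (by fun_prop)) fun y hy => hb _ hy
    obtain ⟨y, hy, h⟩ := hc.exists_isLeast (hne x)
    exact ⟨y, hy, fun y' hy' => h hy'⟩
  choose m hm hmle using hmin
  have hmc : Continuous m := by
    rw [continuous_iff_continuousAt]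
    intro x
    refine tendsto_order.2 ⟨fun u hu => ?_, fun u hu => ?_⟩
    · have hcl : IsClosed (Prod.fst '' ((fun p : P × Icc A B => (p.1, (p.2 : ℝ))) ⁻¹'
          (S ∩ {q | q.2 ≤ u}))) :=
        isClosedMap_fst_of_compactSpace _
          ((hS.inter (isClosed_le (by fun_prop) (by fun_prop))).preimage (by fun_prop))
      have hx : x ∉ Prod.fst '' ((fun p : P × Icc A B => (p.1, (p.2 : ℝ))) ⁻¹'
          (S ∩ {q | q.2 ≤ u})) := by
        rintro ⟨⟨x', y⟩, ⟨h1, h2⟩, rfl⟩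
        exact absurd (hmle _ _ h1) (not_le.2 (lt_of_le_of_lt h2 hu))
      filter_upwards [hcl.isOpen_compl.mem_nhds hx] with x' hx'
      by_contra! hle
      exact hx' ⟨(x', ⟨m x', hb _ (hm x')⟩), ⟨hm x', hle⟩, rfl⟩
    · filter_upwards [hper _ (hm x) (u - m x) (sub_pos.2 hu)] with x' ⟨y, hy, h⟩
      have := hmle _ _ h
      have := (abs_lt.1 hy).2
      linarith
  set S' : Set (P × ℝ) := S ∩ {q | q.2 ≠ m q.1} with hS'
  have hnear : ∀ q ∈ S', ∀ᶠ x in 𝓝 q.1, |q.2 - m q.1| / 2 < |q.2 - m x| := by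
    intro q hq
    have : Tendsto (fun x => |q.2 - m x|) (𝓝 q.1) (𝓝 |q.2 - m q.1|) :=
      (continuous_const.sub hmc).abs.continuousAt
    exact this.eventually (lt_mem_nhds (half_lt_self (abs_pos.2 (sub_ne_zero.2 hq.2))))
  have hS'c : IsClosed S' := by
    rw [← isOpen_compl_iff, isOpen_iff_mem_nhds]
    intro q hq
    by_cases hqS : q ∈ S
    · have hqm : q.2 = m q.1 := by
        by_contra h
        exact hq ⟨hqS, h⟩
      obtain ⟨ε, hε, h⟩ := huniq q hqS
      have h1 : ∀ᶠ p : P × ℝ in 𝓝 q, |p.2 - q.2| < ε := by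
        have : Tendsto (fun p : P × ℝ => |p.2 - q.2|) (𝓝 q) (𝓝 |q.2 - q.2|) :=
          (by fun_prop : Continuous fun p : P × ℝ => |p.2 - q.2|).continuousAt
        exact this.eventually (gt_mem_nhds (by simpa using hε))
      have h2 : ∀ᶠ p : P × ℝ in 𝓝 q, |m p.1 - q.2| < ε := by
        have : Tendsto (fun p : P × ℝ => |m p.1 - q.2|) (𝓝 q) (𝓝 |m q.1 - q.2|) :=
          (by fun_prop : Continuous fun p : P × ℝ => |m p.1 - q.2|).continuousAt
        exact this.eventually (gt_mem_nhds (by simpa [hqm] using hε))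
      filter_upwards [h1, h2, continuous_fst.continuousAt.eventually h] with p h1 h2 h3 h4
      exact h4.2 (h3 _ _ h1 h2 h4.1 (hm _))
    · filter_upwards [hS.isOpen_compl.mem_nhds hqS] with p hp hp'
      exact hp hp'.1
  have hfinS := hfin S hS hb huniq
  obtain ⟨N, f, hfc, hfS, hfi⟩ := ih ({y | (x₀, y) ∈ S'}.ncard)
    (Set.ncard_lt_ncard ⟨fun y hy => hy.1, fun h => (h (hm x₀)).2 rfl⟩ hfinS) S' hS'c
    (fun q hq => hb q hq.1)
    (fun q hq => by
      obtain ⟨ε, hε, h⟩ := huniq q hq.1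
      exact ⟨ε, hε, h.mono fun x hx y y' h1 h2 h3 h4 => hx y y' h1 h2 h3.1 h4.1⟩)
    (fun q hq ε hε => by
      filter_upwards [hnear q hq, hper q hq.1 (min ε (|q.2 - m q.1| / 2))
        (lt_min hε (half_pos (abs_pos.2 (sub_ne_zero.2 hq.2))))] with x h1 ⟨y, h2, h3⟩
      refine ⟨y, h2.trans_le (min_le_left _ _), h3, ?_⟩
      rintro (rfl : y = m x)
      have := h2.trans_le (min_le_right _ _)
      rw [abs_sub_comm] at this
      linarith) rfl
  refine ⟨N + 1, Fin.cons m f, Fin.cases hmc hfc, fun x y => ?_, fun x => ?_⟩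
  · rw [Fin.exists_fin_succ]
    simp only [Fin.cons_zero, Fin.cons_succ]
    rw [← hfS]
    by_cases h : m x = y
    · simp only [h, true_or, iff_true]
      exact h ▸ hm x
    · simp only [h, false_or, hS', mem_inter_iff, mem_ofPred_eq]
      exact ⟨fun h1 => ⟨h1, fun h2 => h h2.symm⟩, fun h1 => h1.1⟩
  · have hne : ∀ j, f j x ≠ m x := fun j => ((hfS x (f j x)).2 ⟨j, rfl⟩).2
    intro i j
    refine Fin.cases ?_ (fun i => ?_) i <;> refine Fin.cases ?_ (fun j => ?_) j
    · simp
    · intro h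
      exact absurd h.symm (by simpa using hne j)
    · intro h
      exact absurd h (by simpa using hne i)
    · intro h
      have := hfi x (by simpa using h : f i x = f j x)
      rw [this]

theorem lipschitz_of_eventually_dist_le {X : Type*} [NormedAddCommGroup X] [NormedSpace ℝ X]
    {f : X → ℝ} (hf : Continuous f) {K : ℝ}
    (h : ∀ x, ∀ᶠ y in 𝓝 x, |f y - f x| ≤ K * dist y x) (x y : X) :
    |f y - f x| ≤ K * dist y x := by
  set u : ℝ → X := fun t => x + t • (y - x) with hu
  have huc : Continuous u := by fun_prop
  have hdist : ∀ s t, s ≤ t → dist (u t) (u s) = (t - s) * dist y x := by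
    intro s t hst
    have : u t - u s = (t - s) • (y - x) := by simp only [hu]; module
    rw [dist_eq_norm, this, norm_smul, Real.norm_of_nonneg (sub_nonneg.2 hst), dist_eq_norm]
  have hcl : IsClosed ({t : ℝ | |f (u t) - f x| ≤ K * (t * dist y x)} ∩ Icc 0 1) :=
    (isClosed_le (by fun_prop) (by fun_prop)).inter isClosed_Icc
  have := hcl.Icc_subset_of_forall_exists_gt (by simp [hu]) (fun t ht s hs => ?_)
    (right_mem_Icc.2 zero_le_one)
  · simpa [hu] using this
  · have h1 : ∀ᶠ r in 𝓝[>] t, |f (u r) - f (u t)| ≤ K * dist (u r) (u t) :=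
      nhdsWithin_le_nhds (huc.continuousAt.eventually (h (u t)))
    have h2 : ∀ᶠ r in 𝓝[>] t, r ∈ Ioc t s := Ioc_mem_nhdsGT hs
    obtain ⟨r, hr, hrs⟩ := (h1.and h2).exists
    refine ⟨r, ?_, hrs⟩
    rw [hdist _ _ hrs.1.le] at hr
    have h3 : |f (u t) - f x| ≤ K * (t * dist y x) := ht.1
    have h4 := abs_sub_le (f (u r)) (f (u t)) (f x)
    change |f (u r) - f x| ≤ K * (r * dist y x)
    linarith

/-- The unique bounded solution of a contracting cross map, as a continuous function of the
itinerary. -/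
theorem exists_itinerary_map (Θ Z : ℕ → ℝ × ℝ → ℝ) {K C : ℝ} (hK0 : 0 ≤ K) (hK1 : K < 1)
    (hΘ : ∀ j p q, |Θ j p - Θ j q| ≤ K * dist p q)
    (hZ : ∀ j p q, |Z j p - Z j q| ≤ K * dist p q)
    (hΘC : ∀ j p, |Θ j p| ≤ C) (hZC : ∀ j p, |Z j p| ≤ C) :
    ∃ x : (ℤ → ℕ) → ℝ × ℝ, Continuous x ∧
      (∀ s, (x s).1 = Θ (s 0) ((x s).2, (x fun i => s (i + 1)).1)) ∧
      (∀ s, (x fun i => s (i + 1)).2 = Z (s 0) ((x s).2, (x fun i => s (i + 1)).1)) ∧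
      ∀ (s : ℤ → ℕ) (q : ℤ → ℝ × ℝ),
        (∀ i, (q i).1 = Θ (s i) ((q i).2, (q (i + 1)).1)) →
        (∀ i, (q (i + 1)).2 = Z (s i) ((q i).2, (q (i + 1)).1)) → x s = q 0 := by
  have hcont : ∀ W : ℕ → ℝ × ℝ → ℝ, (∀ j p q, |W j p - W j q| ≤ K * dist p q) →
      Continuous fun p : ℕ × (ℝ × ℝ) => W p.1 p.2 := by
    intro W hW
    refine continuous_prod_of_discrete_left.2 fun j => ?_
    exact (LipschitzWith.of_dist_le_mul (K := ⟨K, hK0⟩) fun p q => hW j p q).continuous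
  have hsh : Continuous fun (s : ℤ → ℕ) (i : ℤ) => s (i + 1) := by fun_prop
  have hsh' : Continuous fun (s : ℤ → ℕ) (i : ℤ) => s (i - 1) := by fun_prop
  let Φ : ((ℤ → ℕ) →ᵇ ℝ × ℝ) → ((ℤ → ℕ) →ᵇ ℝ × ℝ) := fun x =>
    BoundedContinuousFunction.ofNormedAddCommGroup
      (fun s => (Θ (s 0) ((x s).2, (x fun i => s (i + 1)).1),
        Z (s (-1)) ((x fun i => s (i - 1)).2, (x s).1)))
      (by
        have hx := x.continuous
        refine Continuous.prodMk ?_ ?_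
        · exact (hcont Θ hΘ).comp ((continuous_apply 0).prodMk
            ((continuous_snd.comp hx).prodMk (continuous_fst.comp (hx.comp hsh))))
        · exact (hcont Z hZ).comp ((continuous_apply (-1)).prodMk
            ((continuous_snd.comp (hx.comp hsh')).prodMk (continuous_fst.comp hx))))
      C (fun s => max_le (hΘC _ _) (hZC _ _))
  have hΦ : ContractingWith ⟨K, hK0⟩ Φ := by
    refine ⟨by exact_mod_cast hK1, LipschitzWith.of_dist_le_mul fun x y => ?_⟩
    refine (BoundedContinuousFunction.dist_le (by positivity)).2 fun s => ?_
    have key : ∀ s t, dist ((x s).2, (x t).1) ((y s).2, (y t).1) ≤ dist x y := fun s t =>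
      max_le ((le_max_right _ _).trans (x.dist_coe_le_dist s))
        ((le_max_left _ _).trans (x.dist_coe_le_dist t))
    exact max_le ((hΘ _ _ _).trans (by gcongr; exacts [le_rfl, key _ _]))
      ((hZ _ _ _).trans (by gcongr; exacts [le_rfl, key _ _]))
  obtain ⟨x, hx⟩ : ∃ x, Φ x = x := ⟨_, hΦ.fixedPoint_isFixedPt⟩
  have hx1 : ∀ s, (x s).1 = Θ (s 0) ((x s).2, (x fun i => s (i + 1)).1) := fun s =>
    (congrArg (fun y : (ℤ → ℕ) →ᵇ ℝ × ℝ => (y s).1) hx).symm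
  have hx2 : ∀ s, (x fun i => s (i + 1)).2 = Z (s 0) ((x s).2, (x fun i => s (i + 1)).1) := by
    intro s
    have := (congrArg (fun y : (ℤ → ℕ) →ᵇ ℝ × ℝ => (y fun i => s (i + 1)).2) hx).symm
    simpa [Φ] using this
  refine ⟨x, x.continuous, hx1, hx2, fun s q hq1 hq2 => ?_⟩
  set y : ℤ → ℝ × ℝ := fun i => x fun l => s (l + i) with hy
  have hy1 : ∀ i, (y i).1 = Θ (s i) ((y i).2, (y (i + 1)).1) := by
    intro i
    have := hx1 fun l => s (l + i)
    simpa [hy, add_assoc, add_comm, add_left_comm] using this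
  have hy2 : ∀ i, (y (i + 1)).2 = Z (s i) ((y i).2, (y (i + 1)).1) := by
    intro i
    have := hx2 fun l => s (l + i)
    simpa [hy, add_assoc, add_comm, add_left_comm] using this
  have hbd : ∀ n : ℕ, ∀ i, dist (y i) (q i) ≤ K ^ n * (2 * C) := by
    intro n
    induction n with
    | zero =>
      intro i
      refine max_le ?_ ?_
      · rw [hy1, hq1, Real.dist_eq]
        have := abs_sub (Θ (s i) ((y i).2, (y (i + 1)).1)) (Θ (s i) ((q i).2, (q (i + 1)).1))
        linarith [hΘC (s i) ((y i).2, (y (i + 1)).1), hΘC (s i) ((q i).2, (q (i + 1)).1)]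
      · obtain ⟨i, rfl⟩ : ∃ l, i = l + 1 := ⟨i - 1, by ring⟩
        rw [hy2, hq2, Real.dist_eq]
        have := abs_sub (Z (s i) ((y i).2, (y (i + 1)).1)) (Z (s i) ((q i).2, (q (i + 1)).1))
        linarith [hZC (s i) ((y i).2, (y (i + 1)).1), hZC (s i) ((q i).2, (q (i + 1)).1)]
    | succ n ih =>
      have key : ∀ i, dist ((y i).2, (y (i + 1)).1) ((q i).2, (q (i + 1)).1) ≤ K ^ n * (2 * C) :=
        fun i => max_le ((le_max_right _ _).trans (ih i)) ((le_max_left _ _).trans (ih (i + 1)))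
      intro i
      rw [pow_succ', mul_assoc]
      refine max_le ?_ ?_
      · rw [hy1, hq1, Real.dist_eq]
        exact (hΘ _ _ _).trans (by gcongr; exact key i)
      · obtain ⟨i, rfl⟩ : ∃ l, i = l + 1 := ⟨i - 1, by ring⟩
        rw [hy2, hq2, Real.dist_eq]
        exact (hZ _ _ _).trans (by gcongr; exact key i)
  have hlim : Tendsto (fun n : ℕ => K ^ n * (2 * C)) atTop (𝓝 (0 * (2 * C))) :=
    (tendsto_pow_atTop_nhds_zero_of_lt_one hK0 hK1).mul_const _
  rw [zero_mul] at hlim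
  have h0 : dist (y 0) (q 0) ≤ 0 := ge_of_tendsto' hlim fun n => hbd n 0
  have := dist_le_zero.1 h0
  simpa [hy] using this

/-- The scalar function `F` of a return map `(θ, z) ↦ (θ + a - d log F, b F ^ γ)`, with its
quantitative bounds and the condition that the fold region is mapped into `F < 0`. -/
structure IsReturnFunction (d γ a b k : ℝ) (F F' : ℝ → ℝ → ℝ) : Prop where
  hd : 100 ≤ d
  hγ : 1 < γ
  hb : 0 < b
  hk : 0 < k
  hdk : d * k ≤ 1 / 1000000
  hγb : γ * b * (12 : ℝ) ^ γ ≤ 1 / 10000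
  deriv : ∀ θ z, HasDerivAt (fun t => F t z) (F' θ z) θ
  cont_deriv : Continuous (Function.uncurry F')
  lip_snd : ∀ θ z z', |F θ z - F θ z'| ≤ 2 * k * |z - z'|
  le_bound : ∀ θ z, F θ z ≤ 12
  abs_deriv_le : ∀ θ z, |F' θ z| ≤ 11
  periodic : ∀ θ z, F (θ + 2 * Real.pi) z = F θ z
  neg_left : ∀ θ ∈ Icc (-(Real.pi / 2)) (-(Real.pi / 4)), ∀ z, F θ z < 0
  neg_right : ∀ θ ∈ Icc (5 * Real.pi / 4) (3 * Real.pi / 2), ∀ z, F θ z < 0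
  mid : ∀ θ ∈ Icc 0 Real.pi, ∀ z, 1 / 2 < F θ z
  left : ∀ θ ∈ Icc (-(Real.pi / 4)) 0, ∀ z, 1 ≤ F' θ z ∧ F θ z ≤ 11 / 10
  right : ∀ θ ∈ Icc Real.pi (5 * Real.pi / 4), ∀ z, F' θ z ≤ -1 ∧ F θ z ≤ 11 / 10
  fold : ∀ θ z, 0 < F θ z → |1 - d * F' θ z / F θ z| < 2 →
    F (θ + a - d * Real.log (F θ z)) (b * F θ z ^ γ) < 0

/-- The zero set of a function increasing in its first variable. -/
theorem exists_zero_curve {F F' : ℝ → ℝ → ℝ} {A B K : ℝ} (hAB : A ≤ B)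
    (hF : ∀ θ z, HasDerivAt (fun t => F t z) (F' θ z) θ)
    (hF' : ∀ θ ∈ Icc A B, ∀ z, 1 ≤ F' θ z) (hA : ∀ z, F A z < 0) (hB : ∀ z, 0 < F B z)
    (hlip : ∀ θ z z', |F θ z - F θ z'| ≤ K * |z - z'|) :
    ∃ l : ℝ → ℝ, (∀ z, l z ∈ Ioo A B) ∧ (∀ z, F (l z) z = 0) ∧
      (∀ z, ∀ θ ∈ Icc A B, θ < l z → F θ z < 0) ∧ (∀ z, ∀ θ ∈ Icc A B, l z < θ → 0 < F θ z) ∧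
      ∀ z z', |l z - l z'| ≤ K * |z - z'| := by
  have hc : ∀ z, Continuous fun t => F t z := fun z =>
    continuous_iff_continuousAt.2 fun θ => (hF θ z).continuousAt
  have hgrow : ∀ z, ∀ θ ∈ Icc A B, ∀ θ' ∈ Icc A B, θ ≤ θ' → θ' - θ ≤ F θ' z - F θ z := by
    intro z θ hθ θ' hθ' hle
    have := (convex_Icc A B).mul_sub_le_image_sub_of_le_deriv (f := fun t => F t z) (C := 1)
      (hc z).continuousOn (fun t _ => (hF t z).differentiableAt.differentiableWithinAt)
      (fun t ht => by
        rw [interior_Icc] at ht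
        rw [(hF t z).deriv]
        exact hF' t (Ioo_subset_Icc_self ht) z) θ hθ θ' hθ' hle
    simpa using this
  have hex : ∀ z, ∃ θ ∈ Ioo A B, F θ z = 0 := by
    intro z
    obtain ⟨θ, hθ, h⟩ := intermediate_value_Icc hAB (hc z).continuousOn
      (show (0 : ℝ) ∈ Icc (F A z) (F B z) from ⟨(hA z).le, (hB z).le⟩)
    refine ⟨θ, ⟨lt_of_le_of_ne hθ.1 ?_, lt_of_le_of_ne hθ.2 ?_⟩, h⟩
    · rintro rfl
      exact (hA z).ne h
    · rintro rfl
      exact (hB z).ne' h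
  choose l hl hl0 using hex
  refine ⟨l, hl, hl0, fun z θ hθ h => ?_, fun z θ hθ h => ?_, ?_⟩
  · have := hgrow z θ hθ _ (Ioo_subset_Icc_self (hl z)) h.le
    rw [hl0] at this
    linarith
  · have := hgrow z _ (Ioo_subset_Icc_self (hl z)) θ hθ h.le
    rw [hl0] at this
    linarith
  · have key : ∀ z z', l z ≤ l z' → |l z - l z'| ≤ K * |z - z'| := by
      intro z z' hle
      have h1 := hgrow z _ (Ioo_subset_Icc_self (hl z)) _ (Ioo_subset_Icc_self (hl z')) hle
      have h2 := hlip (l z') z z'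
      rw [hl0] at h1 h2
      rw [abs_sub_comm, abs_of_nonneg (sub_nonneg.2 hle)]
      linarith [le_abs_self (F (l z') z - 0)]
    intro z z'
    rcases le_total (l z) (l z') with h | h
    · exact key z z' h
    · rw [abs_sub_comm, abs_sub_comm z]
      exact key z' z h

theorem abs_max_sub_max_min_le {l l' r r' p p' K : ℝ} (hl : |l - l'| ≤ K) (hr : |r - r'| ≤ K) :
    |max l (min p r) - max l' (min p' r')| ≤ |p - p'| + K := by
  have hK : 0 ≤ K := (abs_nonneg _).trans hl
  have h0 := abs_nonneg (p - p')
  refine (abs_max_sub_max_le_max _ _ _ _).trans (max_le (by linarith) ?_)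
  exact (abs_min_sub_min_le_max _ _ _ _).trans (max_le (by linarith) (by linarith))

namespace IsReturnFunction

variable {d γ a b k : ℝ} {F F' : ℝ → ℝ → ℝ}

theorem k_le (h : IsReturnFunction d γ a b k F F') : k ≤ 1 / 100000000 := by
  have h1 := h.hdk
  have h2 := h.hd
  have h3 := h.hk
  nlinarith

theorem lip (h : IsReturnFunction d γ a b k F F') (θ z θ' z' : ℝ) :
    |F θ z - F θ' z'| ≤ 11 * |θ - θ'| + 2 * k * |z - z'| := by
  have h1 : |F θ z - F θ' z| ≤ 11 * |θ - θ'| := by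
    have := (convex_univ (𝕜 := ℝ) (E := ℝ)).norm_image_sub_le_of_norm_hasDerivWithin_le
      (f := fun t => F t z) (C := 11) (fun t _ => (h.deriv t z).hasDerivWithinAt)
      (fun t _ => h.abs_deriv_le t z) (mem_univ θ') (mem_univ θ)
    simpa [Real.norm_eq_abs] using this
  have := abs_sub_le (F θ z) (F θ' z) (F θ' z')
  linarith [h.lip_snd θ' z z']

theorem continuous (h : IsReturnFunction d γ a b k F F') : Continuous (Function.uncurry F) := by
  have hk := h.hk
  rw [continuous_iff_continuousAt]
  rintro ⟨θ, z⟩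
  refine tendsto_iff_dist_tendsto_zero.2 ?_
  have hlim : Tendsto (fun p : ℝ × ℝ => 11 * |p.1 - θ| + 2 * k * |p.2 - z|) (𝓝 (θ, z))
      (𝓝 (11 * |θ - θ| + 2 * k * |z - z|)) :=
    (by fun_prop : Continuous fun p : ℝ × ℝ => 11 * |p.1 - θ| + 2 * k * |p.2 - z|).continuousAt
  refine squeeze_zero (fun _ => dist_nonneg) (fun p => h.lip p.1 p.2 θ z) ?_
  simpa using hlim

theorem periodic_int (h : IsReturnFunction d γ a b k F F') (θ z : ℝ) (n : ℤ) :
    F (θ + 2 * Real.pi * n) z = F θ z := by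
  have : Function.Periodic (fun t => F t z) (2 * Real.pi) := fun t => h.periodic t z
  have := this.int_mul n θ
  rw [mul_comm]
  exact this

/-- Projection of a vertical line to the closure of `{F > 0}`. -/
theorem exists_clamp (h : IsReturnFunction d γ a b k F F') :
    ∃ g : ℝ → ℝ → ℝ, (∀ φ z, g φ z ∈ Icc (-(Real.pi / 4)) (5 * Real.pi / 4) ∧ 0 ≤ F (g φ z) z) ∧
      (∀ φ z φ' z', |g φ z - g φ' z'| ≤ |φ - φ'| + 2 * k * |z - z'|) ∧
      (∀ z, ∀ θ ∈ Icc (-(Real.pi / 2)) (3 * Real.pi / 2), 0 < F θ z →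
        g θ z = θ ∧ θ ∈ Ioo (-(Real.pi / 4)) (5 * Real.pi / 4)) ∧
      ∃ l : ℝ → ℝ, ∀ z, l z ∈ Ioo (-(Real.pi / 4)) 0 ∧ F (l z) z = 0 ∧ ∀ θ ∈ Ioc (l z) 0, 0 < F θ z := by
  have hpi := Real.pi_pos
  obtain ⟨l, hl, hl0, hln, hlp, hll⟩ := exists_zero_curve (F := F) (F' := F') (A := -(Real.pi / 4))
    (B := 0) (K := 2 * k) (by linarith) h.deriv (fun θ hθ z => (h.left θ hθ z).1)
    (fun z => h.neg_left _ ⟨by linarith, le_rfl⟩ z)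
    (fun z => by linarith [h.mid 0 ⟨le_rfl, hpi.le⟩ z]) h.lip_snd
  obtain ⟨r, hr, hr0, hrn, hrp, hrl⟩ := exists_zero_curve (F := fun θ z => F (-θ) z)
    (F' := fun θ z => -F' (-θ) z) (A := -(5 * Real.pi / 4))
    (B := -Real.pi) (K := 2 * k) (by linarith)
    (fun θ z => by
      have := (h.deriv (-θ) z).scomp θ (hasDerivAt_neg θ)
      simpa [Function.comp_def] using this)
    (fun θ hθ z => by
      have := (h.right (-θ) ⟨by linarith [hθ.2], by linarith [hθ.1]⟩ z).1
      linarith)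
    (fun z => h.neg_right _ ⟨by simp, by linarith⟩ z)
    (fun z => by linarith [h.mid (- -Real.pi) ⟨by linarith, by linarith⟩ z])
    (fun θ => h.lip_snd (-θ))
  have hpos : ∀ z, ∀ θ, l z ≤ θ → θ ≤ -r z → 0 ≤ F θ z := by
    intro z θ h1 h2
    rcases h1.eq_or_lt with rfl | h1
    · exact (hl0 z).ge
    rcases h2.eq_or_lt with rfl | h2
    · exact (hr0 z).ge
    rcases le_total θ 0 with h3 | h3
    · exact (hlp z θ ⟨by linarith [(hl z).1], h3⟩ h1).le
    rcases le_total θ Real.pi with h4 | h4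
    · linarith [h.mid θ ⟨h3, h4⟩ z]
    · have := hrp z (-θ) ⟨by linarith [(hr z).1], by linarith⟩ (by linarith)
      simpa using this.le
  refine ⟨fun φ z => max (l z) (min φ (-r z)), fun φ z => ?_, fun φ z φ' z' => ?_,
    fun z θ hθ hF => ?_, l, fun z => ⟨hl z, hl0 z, fun θ hθ => ?_⟩⟩
  · have h1 : l z ≤ max (l z) (min φ (-r z)) := le_max_left _ _
    have h2 : max (l z) (min φ (-r z)) ≤ -r z :=
      max_le (by linarith [(hl z).2, (hr z).2]) (min_le_right _ _)
    exact ⟨⟨by linarith [(hl z).1], by linarith [(hr z).1]⟩, hpos z _ h1 h2⟩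
  · refine abs_max_sub_max_min_le (hll z z') ?_
    rw [neg_sub_neg, abs_sub_comm]
    exact hrl z z'
  · have h1 : -(Real.pi / 4) < θ := by
      by_contra! hle
      exact absurd (h.neg_left θ ⟨hθ.1, hle⟩ z) (not_lt.2 hF.le)
    have h2 : θ < 5 * Real.pi / 4 := by
      by_contra! hle
      exact absurd (h.neg_right θ ⟨hle, hθ.2⟩ z) (not_lt.2 hF.le)
    have h3 : l z ≤ θ := by
      by_contra! hlt
      exact absurd (hln z θ ⟨h1.le, by linarith [(hl z).2]⟩ hlt) (not_lt.2 hF.le)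
    have h4 : θ ≤ -r z := by
      by_contra! hlt
      have := hrn z (-θ) ⟨by linarith, by linarith [(hr z).2]⟩ (by linarith)
      rw [neg_neg] at this
      exact absurd this (not_lt.2 hF.le)
    exact ⟨by simp [h3, h4], h1, h2⟩
  · exact hlp z θ ⟨by linarith [(hl z).1, hθ.1], hθ.2⟩ hθ.1

/-- Lipschitz bound for the vertical component of the return map. -/
theorem lip_rpow (h : IsReturnFunction d γ a b k F F') {x y : ℝ} (hx : x ∈ Icc (0 : ℝ) 12)
    (hy : y ∈ Icc (0 : ℝ) 12) : |b * x ^ γ - b * y ^ γ| ≤ 1 / 100000 * |x - y| := by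
  have hb := h.hb
  have hγ := h.hγ
  have hder : ∀ t ∈ Icc (0 : ℝ) 12,
      HasDerivWithinAt (fun t : ℝ => b * t ^ γ) (b * (γ * t ^ (γ - 1))) (Icc 0 12) t :=
    fun t _ => ((Real.hasDerivAt_rpow_const (Or.inr hγ.le)).const_mul b).hasDerivWithinAt
  have hbd : ∀ t ∈ Icc (0 : ℝ) 12, ‖b * (γ * t ^ (γ - 1))‖ ≤ 1 / 100000 := by
    intro t ht
    have h1 : t ^ (γ - 1) ≤ (12 : ℝ) ^ (γ - 1) :=
      Real.rpow_le_rpow ht.1 ht.2 (by linarith)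
    have h2 : (12 : ℝ) ^ γ = 12 ^ (γ - 1) * 12 := by
      rw [← Real.rpow_add_one (by norm_num)]
      ring_nf
    have h3 := h.hγb
    have h4 : 0 ≤ t ^ (γ - 1) := Real.rpow_nonneg ht.1 _
    rw [Real.norm_of_nonneg (by positivity)]
    have h5 : b * γ * t ^ (γ - 1) ≤ b * γ * 12 ^ (γ - 1) := by gcongr
    rw [h2] at h3
    linarith
  exact (convex_Icc (0 : ℝ) 12).norm_image_sub_le_of_norm_hasDerivWithin_le hder hbd hy hx

theorem mem_Icc_of_pos (h : IsReturnFunction d γ a b k F F') {θ z : ℝ} (hF : 0 < F θ z) :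
    F θ z ∈ Icc (0 : ℝ) 12 := ⟨hF.le, h.le_bound θ z⟩

theorem lip_vert (h : IsReturnFunction d γ a b k F F') {θ z θ' z' : ℝ} (hF : 0 < F θ z)
    (hF' : 0 < F θ' z') :
    |b * F θ z ^ γ - b * F θ' z' ^ γ| ≤ 1 / 1000 * (|θ - θ'| + |z - z'|) := by
  have h1 := h.lip_rpow (h.mem_Icc_of_pos hF) (h.mem_Icc_of_pos hF')
  have h2 := h.lip θ z θ' z'
  have h3 := h.k_le
  have h4 := abs_nonneg (θ - θ')
  have h5 := abs_nonneg (z - z')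
  nlinarith

theorem vert_mem (h : IsReturnFunction d γ a b k F F') {θ z : ℝ} (hF : 0 < F θ z) :
    b * F θ z ^ γ ∈ Ioc (0 : ℝ) (1 / 1000) := by
  have hb := h.hb
  refine ⟨by positivity, ?_⟩
  have h1 := h.lip_rpow (h.mem_Icc_of_pos hF) (show (0 : ℝ) ∈ Icc (0 : ℝ) 12 by norm_num)
  rw [Real.zero_rpow (by linarith [h.hγ]), mul_zero, sub_zero, sub_zero, abs_of_pos hF,
    abs_of_pos (by positivity)] at h1
  linarith [h.le_bound θ z]

end IsReturnFunction

/-- A Lipschitz projection of vertical lines into the closure of `{F > 0}`. -/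
structure IsClamp (k : ℝ) (F g : ℝ → ℝ → ℝ) : Prop where
  mem : ∀ φ z, g φ z ∈ Icc (-(Real.pi / 4)) (5 * Real.pi / 4)
  nonneg : ∀ φ z, 0 ≤ F (g φ z) z
  lip : ∀ φ z φ' z', |g φ z - g φ' z'| ≤ |φ - φ'| + 2 * k * |z - z'|
  fix : ∀ z, ∀ θ ∈ Icc (-(Real.pi / 2)) (3 * Real.pi / 2), 0 < F θ z →
    g θ z = θ ∧ θ ∈ Ioo (-(Real.pi / 4)) (5 * Real.pi / 4)

/-- The angles `θ` at height `z` whose image winds `n` times and lies on the clamped vertical line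
through `φ`, as a subset of the space of all `((z, φ), θ)`. -/
def crossSet (d γ a b : ℝ) (F g : ℝ → ℝ → ℝ) (n : ℤ) : Set ((ℝ × ℝ) × ℝ) :=
  {q | q.2 ∈ Icc (-(Real.pi / 2)) (3 * Real.pi / 2) ∧ 0 < F q.2 q.1.1 ∧
    q.2 + a - d * Real.log (F q.2 q.1.1) = g q.1.2 (b * F q.2 q.1.1 ^ γ) + 2 * Real.pi * n}

theorem abs_log_sub_log_le {x y m : ℝ} (hm : 0 < m) (hx : m ≤ x) (hy : m ≤ y) :
    |Real.log x - Real.log y| ≤ |x - y| / m := by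
  have key : ∀ x y : ℝ, m ≤ x → m ≤ y → Real.log x - Real.log y ≤ |x - y| / m := by
    intro x y hx hy
    have hx0 := hm.trans_le hx
    have hy0 := hm.trans_le hy
    rw [← Real.log_div hx0.ne' hy0.ne']
    refine (Real.log_le_sub_one_of_pos (by positivity)).trans ?_
    rw [div_sub_one hy0.ne']
    exact div_le_div₀ (abs_nonneg _) (le_abs_self _) hm hy
  rw [abs_sub_le_iff]
  exact ⟨key x y hx hy, by rw [abs_sub_comm]; exact key y x hy hx⟩

namespace IsReturnFunction

variable {d γ a b k : ℝ} {F F' : ℝ → ℝ → ℝ} {g : ℝ → ℝ → ℝ} {n : ℤ}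

theorem nonfold (h : IsReturnFunction d γ a b k F F') (hg : IsClamp k F g)
    {q : (ℝ × ℝ) × ℝ} (hq : q ∈ crossSet d γ a b F g n) :
    2 ≤ |1 - d * F' q.2 q.1.1 / F q.2 q.1.1| := by
  obtain ⟨-, hF, heq⟩ := hq
  by_contra! hlt
  have := h.fold _ _ hF hlt
  rw [heq, h.periodic_int] at this
  exact absurd this (not_lt.2 (hg.nonneg _ _))

theorem ratio (h : IsReturnFunction d γ a b k F F') {θ z : ℝ}
    (hθ : θ ∈ Icc (-(Real.pi / 2)) (3 * Real.pi / 2)) (hF : 0 < F θ z)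
    (hD : 2 ≤ |1 - d * F' θ z / F θ z|) :
    d * k / F θ z ≤ |1 - d * F' θ z / F θ z| / 1000 := by
  have hd := h.hd
  have hk := h.hk
  have hk' := h.k_le
  have harm : F θ z ≤ 11 / 10 → 1 ≤ |F' θ z| →
      d * k / F θ z ≤ |1 - d * F' θ z / F θ z| / 1000 := by
    intro h1 h2
    have h3 : d / F θ z - 1 ≤ |1 - d * F' θ z / F θ z| := by
      have h4 : |d * F' θ z / F θ z| - |(1 : ℝ)| ≤ |d * F' θ z / F θ z - 1| :=
        abs_sub_abs_le_abs_sub _ _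
      rw [abs_sub_comm, abs_div, abs_mul, abs_of_pos hF, abs_of_pos (by linarith : 0 < d),
        abs_one] at h4
      have h5 : d / F θ z ≤ d * |F' θ z| / F θ z := by
        gcongr
        nlinarith
      linarith
    have h6 : 2 ≤ d / F θ z := by
      rw [le_div_iff₀ hF]
      linarith
    have h7 : d * k / F θ z = d / F θ z * k := by ring
    rw [h7]
    nlinarith
  rcases le_total θ 0 with h0 | h0
  · have h1 : -(Real.pi / 4) ≤ θ := by
      by_contra! hlt
      exact absurd (h.neg_left θ ⟨hθ.1, hlt.le⟩ z) (not_lt.2 hF.le)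
    have h2 := h.left θ ⟨h1, h0⟩ z
    exact harm h2.2 (h2.1.trans (le_abs_self _))
  rcases le_total θ Real.pi with h1 | h1
  · have h2 := h.mid θ ⟨h0, h1⟩ z
    have h3 : d * k / F θ z ≤ (1 / 1000000) / (1 / 2) :=
      div_le_div₀ (by norm_num) h.hdk (by norm_num) h2.le
    linarith
  · have h2 : θ ≤ 5 * Real.pi / 4 := by
      by_contra! hlt
      exact absurd (h.neg_right θ ⟨hlt.le, hθ.2⟩ z) (not_lt.2 hF.le)
    have h3 := h.right θ ⟨h1, h2⟩ z
    exact harm h3.2 (by linarith [neg_abs_le (F' θ z)])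

theorem _root_.IsClamp.continuous (hg : IsClamp k F g) : Continuous (Function.uncurry g) := by
  rw [continuous_iff_continuousAt]
  rintro ⟨θ, z⟩
  refine tendsto_iff_dist_tendsto_zero.2 ?_
  have hlim : Tendsto (fun p : ℝ × ℝ => |p.1 - θ| + 2 * k * |p.2 - z|) (𝓝 (θ, z))
      (𝓝 (|θ - θ| + 2 * k * |z - z|)) :=
    (by fun_prop : Continuous fun p : ℝ × ℝ => |p.1 - θ| + 2 * k * |p.2 - z|).continuousAt
  refine squeeze_zero (fun _ => dist_nonneg) (fun p => hg.lip p.1 p.2 θ z) ?_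
  simpa using hlim

theorem isClosed_crossSet (h : IsReturnFunction d γ a b k F F') (hg : IsClamp k F g) :
    IsClosed (crossSet d γ a b F g n) := by
  have hd := h.hd
  have hFc := h.continuous
  have hgc := hg.continuous
  have hγ := h.hγ
  set ε : ℝ := Real.exp ((-(Real.pi / 2) + a - (5 * Real.pi / 4 + 2 * Real.pi * n)) / d) with hε
  have hε0 : 0 < ε := Real.exp_pos _
  have heq : crossSet d γ a b F g n =
      {q | q.2 ∈ Icc (-(Real.pi / 2)) (3 * Real.pi / 2) ∧ ε ≤ F q.2 q.1.1 ∧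
        q.2 + a - d * Real.log (max ε (F q.2 q.1.1)) =
          g q.1.2 (b * (max ε (F q.2 q.1.1)) ^ γ) + 2 * Real.pi * n} := by
    ext q
    constructor
    · rintro ⟨h1, h2, h3⟩
      have h4 : ε ≤ F q.2 q.1.1 := by
        rw [← Real.le_log_iff_exp_le h2, div_le_iff₀ (by linarith)]
        have := (hg.mem q.1.2 (b * F q.2 q.1.1 ^ γ)).2
        linarith [h1.1]
      refine ⟨h1, h4, ?_⟩
      rw [max_eq_right h4]
      exact h3
    · rintro ⟨h1, h2, h3⟩
      rw [max_eq_right h2] at h3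
      exact ⟨h1, hε0.trans_le h2, h3⟩
  rw [heq]
  have hm : Continuous fun q : (ℝ × ℝ) × ℝ => max ε (F q.2 q.1.1) :=
    continuous_const.max (hFc.comp (by fun_prop : Continuous fun q : (ℝ × ℝ) × ℝ => (q.2, q.1.1)))
  have hm0 : ∀ q : (ℝ × ℝ) × ℝ, max ε (F q.2 q.1.1) ≠ 0 := fun q =>
    (hε0.trans_le (le_max_left _ _)).ne'
  refine (isClosed_Icc.preimage continuous_snd).inter (IsClosed.inter ?_ ?_)
  · exact isClosed_le continuous_const
      (hFc.comp (by fun_prop : Continuous fun q : (ℝ × ℝ) × ℝ => (q.2, q.1.1)))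
  · refine isClosed_eq ?_ ?_
    · exact (continuous_snd.add continuous_const).sub (continuous_const.mul (hm.log hm0))
    · refine (hgc.comp ((continuous_snd.comp continuous_fst).prodMk
        (continuous_const.mul (hm.rpow_const fun q => Or.inl (hm0 q))))).add continuous_const

theorem hasDerivAt_angle (h : IsReturnFunction d γ a b k F F') {θ z : ℝ} (hF : 0 < F θ z) :
    HasDerivAt (fun t => t + a - d * Real.log (F t z)) (1 - d * F' θ z / F θ z) θ := by
  have := ((hasDerivAt_id θ).add_const a).sub (((h.deriv θ z).log hF.ne').const_mul d)
  rw [mul_div_assoc]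
  exact this

/-- Near a point of the crossing set the defining equation is strictly monotone in the angle. -/
theorem exists_strictMono (h : IsReturnFunction d γ a b k F F') (hg : IsClamp k F g)
    {q : (ℝ × ℝ) × ℝ} (hq : q ∈ crossSet d γ a b F g n) :
    ∃ ε > 0, ∃ σ : ℝ, ∀ z, |z - q.1.1| < ε →
      (∀ θ, |θ - q.2| < ε → 0 < F θ z ∧ θ ∈ Icc (-(Real.pi / 2)) (3 * Real.pi / 2)) ∧
      ∀ φ θ θ', |θ - q.2| < ε → |θ' - q.2| < ε → θ < θ' →
        σ * (θ + a - d * Real.log (F θ z) - g φ (b * F θ z ^ γ)) <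
          σ * (θ' + a - d * Real.log (F θ' z) - g φ (b * F θ' z ^ γ)) := by
  have hk := h.hk
  have hkl := h.k_le
  have hpi := Real.pi_pos
  have hD := h.nonfold hg hq
  obtain ⟨⟨z₀, φ₀⟩, θ₀⟩ := q
  obtain ⟨hθ, hF, -⟩ := hq
  dsimp only at hD hθ hF ⊢
  obtain ⟨σ, hσ, hσD⟩ : ∃ σ : ℝ, |σ| = 1 ∧ σ * (1 - d * F' θ₀ z₀ / F θ₀ z₀) =
      |1 - d * F' θ₀ z₀ / F θ₀ z₀| := by
    rcases abs_cases (1 - d * F' θ₀ z₀ / F θ₀ z₀) with h1 | h1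
    · exact ⟨1, by simp, by rw [h1.1]; ring⟩
    · exact ⟨-1, by simp, by rw [h1.1]; ring⟩
  have hFc : ContinuousAt (fun p : ℝ × ℝ => F p.1 p.2) (θ₀, z₀) := h.continuous.continuousAt
  have hFc' : ContinuousAt (fun p : ℝ × ℝ => F' p.1 p.2) (θ₀, z₀) := h.cont_deriv.continuousAt
  have hDc : ContinuousAt (fun p : ℝ × ℝ => σ * (1 - d * F' p.1 p.2 / F p.1 p.2)) (θ₀, z₀) :=
    continuousAt_const.mul (continuousAt_const.sub ((continuousAt_const.mul hFc').div hFc hF.ne'))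
  have e1 : ∀ᶠ p : ℝ × ℝ in 𝓝 (θ₀, z₀), 0 < F p.1 p.2 := hFc.eventually (lt_mem_nhds hF)
  have e2 : ∀ᶠ p : ℝ × ℝ in 𝓝 (θ₀, z₀), 1 < σ * (1 - d * F' p.1 p.2 / F p.1 p.2) :=
    hDc.eventually (lt_mem_nhds (by
      show 1 < σ * (1 - d * F' θ₀ z₀ / F θ₀ z₀)
      rw [hσD]
      linarith))
  have hθ' := (hg.fix z₀ θ₀ hθ hF).2
  have e3 : ∀ᶠ p : ℝ × ℝ in 𝓝 (θ₀, z₀), p.1 ∈ Icc (-(Real.pi / 2)) (3 * Real.pi / 2) :=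
    continuousAt_fst.eventually (Icc_mem_nhds (by linarith [hθ'.1]) (by linarith [hθ'.2]))
  obtain ⟨ε, hε, hball⟩ := Metric.eventually_nhds_iff.1 (e1.and (e2.and e3))
  have hbox : ∀ z θ, |z - z₀| < ε → |θ - θ₀| < ε → 0 < F θ z ∧
      1 < σ * (1 - d * F' θ z / F θ z) ∧ θ ∈ Icc (-(Real.pi / 2)) (3 * Real.pi / 2) :=
    fun z θ hz hθ => hball (y := (θ, z)) (max_lt hθ hz)
  refine ⟨ε, hε, σ, fun z hz => ⟨fun θ hθ => ⟨(hbox z θ hz hθ).1, (hbox z θ hz hθ).2.2⟩, ?_⟩⟩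
  intro φ θ θ' h1 h2 hlt
  have hin : ∀ t ∈ Icc θ θ', |t - θ₀| < ε := by
    intro t ht
    rw [abs_lt] at h1 h2 ⊢
    exact ⟨by linarith [ht.1], by linarith [ht.2]⟩
  have hder : ∀ t ∈ Icc θ θ', HasDerivAt (fun t => σ * (t + a - d * Real.log (F t z)))
      (σ * (1 - d * F' t z / F t z)) t := fun t ht =>
    (h.hasDerivAt_angle (hbox z t hz (hin t ht)).1).const_mul σ
  have hmv := (convex_Icc θ θ').mul_sub_le_image_sub_of_le_deriv (C := 1)
    (fun t ht => (hder t ht).continuousAt.continuousWithinAt)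
    (fun t ht => (hder t (interior_subset ht)).differentiableAt.differentiableWithinAt)
    (fun t ht => by
      rw [(hder t (interior_subset ht)).deriv]
      exact (hbox z t hz (hin t (interior_subset ht))).2.1.le)
    θ (left_mem_Icc.2 hlt.le) θ' (right_mem_Icc.2 hlt.le) hlt.le
  have hv := h.lip_vert (hbox z θ' hz h2).1 (hbox z θ hz h1).1
  have hgl := hg.lip φ (b * F θ' z ^ γ) φ (b * F θ z ^ γ)
  rw [sub_self, abs_zero, add_zero, abs_of_pos (sub_pos.2 hlt)] at hv
  rw [sub_self, abs_zero, zero_add] at hgl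
  have hs : σ * (g φ (b * F θ' z ^ γ) - g φ (b * F θ z ^ γ)) ≤
      |g φ (b * F θ' z ^ γ) - g φ (b * F θ z ^ γ)| := by
    refine (le_abs_self _).trans ?_
    rw [abs_mul, hσ, one_mul]
  nlinarith [abs_nonneg (b * F θ' z ^ γ - b * F θ z ^ γ)]

theorem crossSet_unique (h : IsReturnFunction d γ a b k F F') (hg : IsClamp k F g)
    {q : (ℝ × ℝ) × ℝ} (hq : q ∈ crossSet d γ a b F g n) :
    ∃ ε > 0, ∀ᶠ x in 𝓝 q.1, ∀ y y', |y - q.2| < ε → |y' - q.2| < ε →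
      (x, y) ∈ crossSet d γ a b F g n → (x, y') ∈ crossSet d γ a b F g n → y = y' := by
  obtain ⟨ε, hε, σ, hmono⟩ := h.exists_strictMono hg hq
  refine ⟨ε, hε, ?_⟩
  have hz : ∀ᶠ x : ℝ × ℝ in 𝓝 q.1, |x.1 - q.1.1| < ε :=
    continuousAt_fst.eventually
      (show ∀ᶠ y in 𝓝 q.1.1, |y - q.1.1| < ε from Metric.ball_mem_nhds q.1.1 hε)
  filter_upwards [hz] with x hx y y' hy hy' h1 h2
  have e1 := h1.2.2
  have e2 := h2.2.2
  dsimp only at e1 e2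
  rcases lt_trichotomy y y' with hlt | heq | hlt
  · have := (hmono x.1 hx).2 x.2 y y' hy hy' hlt
    rw [e1, e2] at this
    ring_nf at this
    exact absurd this (lt_irrefl _)
  · exact heq
  · have := (hmono x.1 hx).2 x.2 y' y hy' hy hlt
    rw [e1, e2] at this
    ring_nf at this
    exact absurd this (lt_irrefl _)

theorem continuousAt_cross (h : IsReturnFunction d γ a b k F F') (hg : IsClamp k F g)
    {x : ℝ × ℝ} {θ : ℝ} (hF : 0 < F θ x.1) :
    ContinuousAt (fun q : (ℝ × ℝ) × ℝ => q.2 + a - d * Real.log (F q.2 q.1.1) -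
      g q.1.2 (b * F q.2 q.1.1 ^ γ)) (x, θ) := by
  have hFc : ContinuousAt (fun q : (ℝ × ℝ) × ℝ => F q.2 q.1.1) (x, θ) :=
    (h.continuous.comp
      (by fun_prop : Continuous fun q : (ℝ × ℝ) × ℝ => (q.2, q.1.1))).continuousAt
  refine ((continuousAt_snd.add continuousAt_const).sub
    (continuousAt_const.mul (hFc.log hF.ne'))).sub ?_
  exact ContinuousAt.comp (g := Function.uncurry g)
    (f := fun q : (ℝ × ℝ) × ℝ => (q.1.2, b * F q.2 q.1.1 ^ γ))
    (hg.continuous).continuousAt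
    ((by fun_prop : Continuous fun q : (ℝ × ℝ) × ℝ => q.1.2).continuousAt.prodMk
      (continuousAt_const.mul (hFc.rpow_const (Or.inl hF.ne'))))

theorem crossSet_persist (h : IsReturnFunction d γ a b k F F') (hg : IsClamp k F g)
    {q : (ℝ × ℝ) × ℝ} (hq : q ∈ crossSet d γ a b F g n) (ε : ℝ) (hε : 0 < ε) :
    ∀ᶠ x in 𝓝 q.1, ∃ y, |y - q.2| < ε ∧ (x, y) ∈ crossSet d γ a b F g n := by
  obtain ⟨ε', hε', σ, hmono⟩ := h.exists_strictMono hg hq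
  obtain ⟨⟨z₀, φ₀⟩, θ₀⟩ := q
  have hq3 : θ₀ + a - d * Real.log (F θ₀ z₀) = g φ₀ (b * F θ₀ z₀ ^ γ) + 2 * Real.pi * n := hq.2.2
  dsimp only at hmono ⊢
  set δ := min ε ε' / 2 with hδ
  have hδ0 : 0 < δ := half_pos (lt_min hε hε')
  have hδ1 : δ < ε := (half_lt_self (lt_min hε hε')).trans_le (min_le_left _ _)
  have hδ2 : δ < ε' := (half_lt_self (lt_min hε hε')).trans_le (min_le_right _ _)
  have hz₀ : |z₀ - z₀| < ε' := by simpa using hε'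
  have hm : |θ₀ - δ - θ₀| < ε' := by simpa [abs_of_pos hδ0] using hδ2
  have hp : |θ₀ + δ - θ₀| < ε' := by simpa [abs_of_pos hδ0] using hδ2
  have h0 : |θ₀ - θ₀| < ε' := by simpa using hε'
  have s1 := (hmono z₀ hz₀).2 φ₀ _ _ hm h0 (by linarith)
  have s2 := (hmono z₀ hz₀).2 φ₀ _ _ h0 hp (by linarith)
  rw [hq3, add_sub_cancel_left] at s1 s2
  have hcomp : ∀ θ, |θ - θ₀| < ε' → ContinuousAt (fun x : ℝ × ℝ => σ * (θ + a -
      d * Real.log (F θ x.1) - g x.2 (b * F θ x.1 ^ γ))) (z₀, φ₀) := fun θ hθ =>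
    continuousAt_const.mul (ContinuousAt.comp (f := fun x : ℝ × ℝ => (x, θ))
      (h.continuousAt_cross hg (x := (z₀, φ₀)) ((hmono z₀ hz₀).1 θ hθ).1)
      (by fun_prop : Continuous fun x : ℝ × ℝ => (x, θ)).continuousAt)
  have e1 := (hcomp _ hm).eventually (gt_mem_nhds s1)
  have e2 := (hcomp _ hp).eventually (lt_mem_nhds s2)
  have e3 : ∀ᶠ x : ℝ × ℝ in 𝓝 (z₀, φ₀), |x.1 - z₀| < ε' :=
    (continuousAt_fst (p := (z₀, φ₀))).eventually
      (show ∀ᶠ y in 𝓝 z₀, |y - z₀| < ε' from Metric.ball_mem_nhds z₀ hε')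
  filter_upwards [e1, e2, e3] with x h1 h2 h3
  have hin : ∀ t ∈ Icc (θ₀ - δ) (θ₀ + δ), |t - θ₀| ≤ δ := fun t ht =>
    abs_le.2 ⟨by linarith [ht.1], by linarith [ht.2]⟩
  obtain ⟨θ, hθ, hθ0⟩ := intermediate_value_Icc (by linarith : θ₀ - δ ≤ θ₀ + δ)
    (f := fun θ => σ * (θ + a - d * Real.log (F θ x.1) - g x.2 (b * F θ x.1 ^ γ)))
    (fun t ht => (continuousAt_const.mul (ContinuousAt.comp (f := fun t : ℝ => (x, t))
      (h.continuousAt_cross hg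
        ((hmono x.1 h3).1 t ((hin t ht).trans_lt hδ2)).1)
      (by fun_prop : Continuous fun t : ℝ => (x, t)).continuousAt)).continuousWithinAt)
    (show σ * (2 * Real.pi * n) ∈ _ from ⟨h1.le, h2.le⟩)
  have hσ : σ ≠ 0 := by
    rintro rfl
    simp at s1
  have h5 := (hmono x.1 h3).1 θ ((hin θ hθ).trans_lt hδ2)
  have h6 := mul_left_cancel₀ hσ hθ0
  exact ⟨θ, (hin θ hθ).trans_lt hδ1, h5.2, h5.1, by linarith⟩

theorem crossSet_lip (h : IsReturnFunction d γ a b k F F') (hg : IsClamp k F g)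
    {q : (ℝ × ℝ) × ℝ} (hq : q ∈ crossSet d γ a b F g n) :
    ∀ᶠ p in 𝓝 q, p ∈ crossSet d γ a b F g n → |p.2 - q.2| ≤ 3 / 5 * dist p.1 q.1 := by
  have hk := h.hk
  have hkl := h.k_le
  have hd := h.hd
  have hD := h.nonfold hg hq
  have hR := h.ratio hq.1 hq.2.1 hD
  obtain ⟨⟨z₀, φ₀⟩, θ₀⟩ := q
  obtain ⟨hθ, hF, heq⟩ := hq
  dsimp only at hD hR hθ hF heq ⊢
  set D := 1 - d * F' θ₀ z₀ / F θ₀ z₀ with hDdef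
  have hFc : Continuous fun p : ℝ × ℝ => F p.1 p.2 := h.continuous
  have e1 : ∀ᶠ p : (ℝ × ℝ) × ℝ in 𝓝 ((z₀, φ₀), θ₀), F θ₀ z₀ / 2 < F p.2 p.1.1 :=
    (hFc.comp (by fun_prop : Continuous fun p : (ℝ × ℝ) × ℝ =>
      (p.2, p.1.1))).continuousAt.eventually (lt_mem_nhds (half_lt_self hF))
  have e2 : ∀ᶠ p : (ℝ × ℝ) × ℝ in 𝓝 ((z₀, φ₀), θ₀), F θ₀ z₀ / 2 < F p.2 z₀ :=
    (hFc.comp (by fun_prop : Continuous fun p : (ℝ × ℝ) × ℝ =>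
      (p.2, z₀))).continuousAt.eventually (lt_mem_nhds (half_lt_self hF))
  have e3 : ∀ᶠ θ in 𝓝 θ₀, |θ + a - d * Real.log (F θ z₀) - (θ₀ + a - d * Real.log (F θ₀ z₀)) -
      (θ - θ₀) * D| ≤ 1 / 100 * |θ - θ₀| := by
    have := (hasDerivAt_iff_isLittleO.1 (h.hasDerivAt_angle hF)).def
      (show (0 : ℝ) < 1 / 100 by norm_num)
    simpa [Real.norm_eq_abs] using this
  filter_upwards [e1, e2, continuousAt_snd.eventually e3] with p h1 h2 h3 hp
  obtain ⟨⟨z, φ⟩, θ⟩ := p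
  obtain ⟨-, hFp, heqp⟩ := hp
  dsimp only at h1 h2 h3 hFp heqp ⊢
  have hlog := abs_log_sub_log_le (half_pos hF) h1.le h2.le
  have hFl := h.lip_snd θ z z₀
  have hv := h.lip_vert hFp hF
  have hgl := hg.lip φ (b * F θ z ^ γ) φ₀ (b * F θ₀ z₀ ^ γ)
  have hz : |z - z₀| ≤ dist (z, φ) (z₀, φ₀) := le_max_left _ _
  have hφ : |φ - φ₀| ≤ dist (z, φ) (z₀, φ₀) := le_max_right _ _
  set M := dist (z, φ) (z₀, φ₀) with hM
  set A := |θ - θ₀| with hA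
  have hA0 : 0 ≤ A := abs_nonneg _
  have hz0 : 0 ≤ |z - z₀| := abs_nonneg _
  have hdl : d * |Real.log (F θ z) - Real.log (F θ z₀)| ≤ 4 * (|D| / 1000) * M := by
    have t1 : d * |Real.log (F θ z) - Real.log (F θ z₀)| ≤
        d * ((2 * k * |z - z₀|) / (F θ₀ z₀ / 2)) := by
      gcongr
      exact hlog.trans (by gcongr)
    have t2 : d * ((2 * k * |z - z₀|) / (F θ₀ z₀ / 2)) = 4 * (d * k / F θ₀ z₀) * |z - z₀| := by
      field_simp
      ring
    rw [t2] at t1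
    refine t1.trans ?_
    gcongr
  have hgv : 2 * k * |b * F θ z ^ γ - b * F θ₀ z₀ ^ γ| ≤ 1 / 100 * (A + M) := by
    have := abs_nonneg (b * F θ z ^ γ - b * F θ₀ z₀ ^ γ)
    nlinarith
  have hmain : A * |D| ≤ 1 / 100 * A + (M + 1 / 100 * (A + M)) + 4 * (|D| / 1000) * M := by
    have t1 : (θ - θ₀) * D = -(θ + a - d * Real.log (F θ z₀) -
        (θ₀ + a - d * Real.log (F θ₀ z₀)) - (θ - θ₀) * D) +
        (g φ (b * F θ z ^ γ) - g φ₀ (b * F θ₀ z₀ ^ γ)) +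
        d * (Real.log (F θ z) - Real.log (F θ z₀)) := by
      linear_combination heqp - heq
    have t2 : A * |D| = |(θ - θ₀) * D| := (abs_mul _ _).symm
    rw [t2, t1]
    refine (abs_add_three _ _ _).trans ?_
    rw [abs_neg, abs_mul d, abs_of_pos (by linarith : 0 < d)]
    linarith
  by_contra! hlt
  nlinarith

theorem crossSet_nonempty (h : IsReturnFunction d γ a b k F F') (hg : IsClamp k F g)
    {z φ l : ℝ} (hl : l ∈ Ioo (-(Real.pi / 4)) 0) (hl0 : F l z = 0)
    (hlp : ∀ θ ∈ Ioc l 0, 0 < F θ z)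
    (hn : a - d * Real.log (1 / 2) + Real.pi / 4 ≤ 2 * Real.pi * n) :
    ∃ θ, ((z, φ), θ) ∈ crossSet d γ a b F g n := by
  have hpi := Real.pi_pos
  have hd := h.hd
  set δ := Real.exp ((-(Real.pi / 4) + a - (5 * Real.pi / 4 + 2 * Real.pi * n)) / d) with hδ
  have hFc : Continuous fun t => F t z := h.continuous.comp (by fun_prop :
    Continuous fun t : ℝ => (t, z))
  have e1 : ∀ᶠ t in 𝓝[>] l, F t z < δ :=
    nhdsWithin_le_nhds (hFc.continuousAt.eventually (gt_mem_nhds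
      (show F l z < δ by rw [hl0]; exact Real.exp_pos _)))
  obtain ⟨t, ht, htl⟩ := (e1.and (Ioc_mem_nhdsGT hl.2)).exists
  have hgt := hg.mem φ (b * F t z ^ γ)
  have hg0 := hg.mem φ (b * F 0 z ^ γ)
  have hlt : Real.log (F t z) ≤ (-(Real.pi / 4) + a - (5 * Real.pi / 4 + 2 * Real.pi * n)) / d :=
    (Real.log_le_iff_le_exp (hlp t htl)).2 ht.le
  rw [le_div_iff₀ (by linarith)] at hlt
  have hl1 : Real.log (1 / 2) ≤ Real.log (F 0 z) :=
    Real.log_le_log (by norm_num) (h.mid 0 ⟨le_rfl, hpi.le⟩ z).le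
  obtain ⟨θ, hθ, hθ0⟩ := intermediate_value_Icc' htl.2
    (f := fun θ => θ + a - d * Real.log (F θ z) - g φ (b * F θ z ^ γ))
    (fun s hs => (ContinuousAt.comp (f := fun t : ℝ => ((z, φ), t))
      (h.continuousAt_cross hg (x := (z, φ)) (hlp s ⟨htl.1.trans_le hs.1, hs.2⟩))
      (by fun_prop : Continuous fun t : ℝ => (((z, φ), t) : (ℝ × ℝ) × ℝ)).continuousAt).continuousWithinAt)
    (show 2 * Real.pi * n ∈ _ from ⟨by nlinarith [hg0.1], by
      linarith [hgt.2, htl.1, hl.1]⟩)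
  dsimp only at hθ0
  exact ⟨θ, ⟨by linarith [htl.1, hl.1, hθ.1], by linarith [hθ.2]⟩,
    hlp θ ⟨htl.1.trans_le hθ.1, hθ.2⟩, by dsimp only; linarith⟩

/-- The branches of the inverse return map, in cross form, enumerated by `ℕ`. -/
theorem exists_branches (h : IsReturnFunction d γ a b k F F') :
    ∃ g, IsClamp k F g ∧ ∃ (Θ : ℕ → ℝ × ℝ → ℝ) (ν : ℕ → ℤ),
      (∀ j p q, |Θ j p - Θ j q| ≤ 3 / 5 * dist p q) ∧
      (∀ n x θ, (x, θ) ∈ crossSet d γ a b F g n ↔ ∃ j, ν j = n ∧ Θ j x = θ) ∧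
      ∀ x j j', ν j = ν j' → Θ j x = Θ j' x → j = j' := by
  obtain ⟨g, hg1, hg2, hg3, l, hl⟩ := h.exists_clamp
  have hg : IsClamp k F g := ⟨fun φ z => (hg1 φ z).1, fun φ z => (hg1 φ z).2, hg2, hg3⟩
  refine ⟨g, hg, ?_⟩
  have hsheets := fun n => exists_sheets (crossSet d γ a b F g n) (h.isClosed_crossSet hg)
    (fun q hq => hq.1) (fun q hq => h.crossSet_unique hg hq)
    (fun q hq => h.crossSet_persist hg hq)
  choose N f hfc hfS hfi using hsheets
  have hinf : Infinite (Σ n, Fin (N n)) := by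
    obtain ⟨m, hm⟩ := exists_nat_ge ((a - d * Real.log (1 / 2) + Real.pi / 4) / (2 * Real.pi))
    rw [div_le_iff₀ (by positivity)] at hm
    have hex : ∀ i : ℕ, Nonempty (Fin (N (m + i))) := by
      intro i
      obtain ⟨θ, hθ⟩ := h.crossSet_nonempty hg (n := m + i) (φ := 0) (hl 0).1 (hl 0).2.1
        (hl 0).2.2 (by
          have : (0 : ℝ) ≤ Real.pi * i := by positivity
          push_cast
          linarith)
      obtain ⟨j, -⟩ := (hfS _ _ _).1 hθ
      exact ⟨j⟩
    refine Infinite.of_injective (fun i : ℕ => (⟨m + i, (hex i).some⟩ : Σ n, Fin (N n))) ?_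
    intro i i' hii
    have := congrArg Sigma.fst hii
    simpa using this
  obtain ⟨e⟩ := nonempty_denumerable (Σ n, Fin (N n))
  have hlip : ∀ n j p q, |f n j p - f n j q| ≤ 3 / 5 * dist p q := by
    intro n j p q
    refine lipschitz_of_eventually_dist_le (hfc n j) (fun x => ?_) q p
    have hx : (x, f n j x) ∈ crossSet d γ a b F g n := (hfS n x _).2 ⟨j, rfl⟩
    have hc : ContinuousAt (fun y => (y, f n j y)) x :=
      (continuous_id.prodMk (hfc n j)).continuousAt
    filter_upwards [hc.eventually (h.crossSet_lip hg hx)] with y hy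
    exact hy ((hfS n y _).2 ⟨j, rfl⟩)
  let s : ℕ → Σ n, Fin (N n) := (Denumerable.eqv (Σ n, Fin (N n))).symm
  have hs : Function.Bijective s := (Denumerable.eqv (Σ n, Fin (N n))).symm.bijective
  refine ⟨fun j => f (s j).1 (s j).2, fun j => (s j).1, fun j => hlip _ _, fun n x θ => ?_,
    fun x j j' h1 h2 => hs.1 ?_⟩
  · rw [hfS]
    constructor
    · rintro ⟨i, hi⟩
      obtain ⟨j, hj⟩ := hs.2 ⟨n, i⟩
      refine ⟨j, congrArg Sigma.fst hj, ?_⟩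
      dsimp only
      rw [hj]
      exact hi
    · rintro ⟨j, rfl, hj⟩
      exact ⟨_, hj⟩
  · dsimp only at h1 h2
    revert h1 h2
    generalize s j = u
    generalize s j' = v
    obtain ⟨n, i⟩ := u
    obtain ⟨n', i'⟩ := v
    rintro (rfl : n = n') h2
    exact congrArg (Sigma.mk n) (hfi n x h2)

end IsReturnFunction

/-- A continuous symbolic coding of the bi-infinite orbits of `(θ, z) ↦ (θ + a - d log F, b F ^ γ)`,
where the first coordinate is reduced modulo `2π` and `ν` records the winding number. -/
structure IsCoding (d γ a b : ℝ) (F : ℝ → ℝ → ℝ) (ν : ℕ → ℤ) (x : (ℤ → ℕ) → ℝ × ℝ) : Prop where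
  continuous : Continuous x
  mem : ∀ s, (x s).1 ∈ Ioo (-(Real.pi / 4)) (5 * Real.pi / 4)
  pos : ∀ s, 0 < F (x s).1 (x s).2
  angle : ∀ s, (x s).1 + a - d * Real.log (F (x s).1 (x s).2) =
    (x fun i => s (i + 1)).1 + 2 * Real.pi * ν (s 0)
  height : ∀ s, (x fun i => s (i + 1)).2 = b * F (x s).1 (x s).2 ^ γ
  complete : ∀ (q : ℤ → ℝ × ℝ) (m : ℤ → ℤ),
    (∀ i, (q i).1 ∈ Icc (-(Real.pi / 2)) (3 * Real.pi / 2)) → (∀ i, 0 < F (q i).1 (q i).2) →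
    (∀ i, (q i).1 + a - d * Real.log (F (q i).1 (q i).2) =
      (q (i + 1)).1 + 2 * Real.pi * m i) →
    (∀ i, (q (i + 1)).2 = b * F (q i).1 (q i).2 ^ γ) → ∃ s, x s = q 0
  symbol : ∀ (l : Filter (ℤ → ℕ)) (u : (ℤ → ℕ) → ℤ → ℕ) (s : ℤ → ℕ),
    Tendsto (fun t => x (u t)) l (𝓝 (x s)) →
    Tendsto (fun t => x fun i => u t (i + 1)) l (𝓝 (x fun i => s (i + 1))) →
    ∀ᶠ t in l, u t 0 = s 0

namespace IsReturnFunction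

variable {d γ a b k : ℝ} {F F' : ℝ → ℝ → ℝ}

theorem exists_isCoding (h : IsReturnFunction d γ a b k F F') :
    ∃ ν x, IsCoding d γ a b F ν x := by
  obtain ⟨g, hg, Θ, ν, hΘ, hmem, hinj⟩ := h.exists_branches
  have hpi := Real.pi_lt_d2
  have hpi0 := Real.pi_pos
  have hcr : ∀ j p, (p, Θ j p) ∈ crossSet d γ a b F g (ν j) := fun j p =>
    (hmem _ _ _).2 ⟨j, rfl, rfl⟩
  obtain ⟨x, hxc, hx1, hx2, hxu⟩ := exists_itinerary_map Θ
    (fun j p => b * F (Θ j p) p.1 ^ γ) (K := 3 / 5) (C := 5) (by norm_num) (by norm_num) hΘ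
    (fun j p q => by
      have h1 := h.lip_vert (hcr j p).2.1 (hcr j q).2.1
      have h2 := hΘ j p q
      have h3 : |p.1 - q.1| ≤ dist p q := le_max_left _ _
      have h4 : 0 ≤ dist p q := dist_nonneg
      dsimp only at h1 ⊢
      linarith)
    (fun j p => by
      have := (hcr j p).1
      rw [abs_le]
      constructor <;> linarith [this.1, this.2])
    (fun j p => by
      have := h.vert_mem (hcr j p).2.1
      dsimp only at this ⊢
      rw [abs_of_pos this.1]
      linarith [this.2])
  have hxcr : ∀ s, (((x s).2, (x fun i => s (i + 1)).1), (x s).1) ∈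
      crossSet d γ a b F g (ν (s 0)) := fun s => (hmem _ _ _).2 ⟨s 0, rfl, (hx1 s).symm⟩
  have hheight : ∀ s, (x fun i => s (i + 1)).2 = b * F (x s).1 (x s).2 ^ γ := by
    intro s
    rw [hx2 s, ← hx1 s]
  have hfix : ∀ s, g (x s).1 (x s).2 = (x s).1 ∧
      (x s).1 ∈ Ioo (-(Real.pi / 4)) (5 * Real.pi / 4) := fun s =>
    hg.fix _ _ (hxcr s).1 (hxcr s).2.1
  have hangle : ∀ s, (x s).1 + a - d * Real.log (F (x s).1 (x s).2) =
      (x fun i => s (i + 1)).1 + 2 * Real.pi * ν (s 0) := by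
    intro s
    have := (hxcr s).2.2
    dsimp only at this
    rw [this, ← hheight s, (hfix _).1]
  refine ⟨ν, x, hxc, fun s => (hfix s).2, fun s => (hxcr s).2.1, hangle, hheight, ?_, ?_⟩
  · intro q m hq hpos hang hht
    have hsym : ∀ i, ∃ j, ν j = m i ∧ Θ j ((q i).2, (q (i + 1)).1) = (q i).1 := fun i =>
      (hmem _ _ _).1 ⟨hq i, hpos i, by
        dsimp only
        rw [hang i, ← hht i, (hg.fix _ _ (hq (i + 1)) (hpos (i + 1))).1]⟩
    choose s hs1 hs2 using hsym
    refine ⟨s, hxu s q (fun i => (hs2 i).symm) fun i => ?_⟩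
    rw [hs2 i]
    exact hht i
  · intro l u s h1 h2
    have hF := (h.continuous.tendsto (x s)).comp h1
    have hlog : Tendsto (fun t => Real.log (F (x (u t)).1 (x (u t)).2)) l
        (𝓝 (Real.log (F (x s).1 (x s).2))) := hF.log (hxcr s).2.1.ne'
    have h11 : Tendsto (fun t => (x (u t)).1) l (𝓝 (x s).1) :=
      (continuous_fst.tendsto _).comp h1
    have h12 : Tendsto (fun t => (x (u t)).2) l (𝓝 (x s).2) :=
      (continuous_snd.tendsto _).comp h1
    have h21 : Tendsto (fun t => (x fun i => u t (i + 1)).1) l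
        (𝓝 (x fun i => s (i + 1)).1) := (continuous_fst.tendsto _).comp h2
    have hν : Tendsto (fun t => (ν (u t 0) : ℝ)) l (𝓝 (ν (s 0))) := by
      have := (((h11.add_const a).sub (hlog.const_mul d)).sub h21).div_const (2 * Real.pi)
      have e : ∀ s, ((x s).1 + a - d * Real.log (F (x s).1 (x s).2) -
          (x fun i => s (i + 1)).1) / (2 * Real.pi) = ν (s 0) := by
        intro s
        rw [hangle s]
        field_simp
        ring
      simpa only [e] using this
    have hν' : ∀ᶠ t in l, ν (u t 0) = ν (s 0) := by
      filter_upwards [hν.eventually (Metric.ball_mem_nhds _ one_pos)] with t ht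
      have h3 : |(ν (u t 0) : ℝ) - ν (s 0)| < 1 := ht
      have h4 : |ν (u t 0) - ν (s 0)| < 1 := by exact_mod_cast h3
      linarith [Int.abs_lt_one_iff.1 h4]
    obtain ⟨ε, hε, hun⟩ := h.crossSet_unique hg (hxcr s)
    have hp : Tendsto (fun t => ((x (u t)).2, (x fun i => u t (i + 1)).1)) l
        (𝓝 ((x s).2, (x fun i => s (i + 1)).1)) := h12.prodMk_nhds h21
    have hΘc : Continuous (Θ (s 0)) :=
      (LipschitzWith.of_dist_le_mul (K := ⟨3 / 5, by norm_num⟩)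
        fun p q => hΘ (s 0) p q).continuous
    have hΘt := (hΘc.tendsto _).comp hp
    rw [← hx1 s] at hΘt
    filter_upwards [hν', hp.eventually hun, h11.eventually (Metric.ball_mem_nhds _ hε),
      hΘt.eventually (Metric.ball_mem_nhds _ hε)] with t h3 h4 h5 h6
    refine hinj ((x (u t)).2, (x fun i => u t (i + 1)).1) _ _ h3 ?_
    rw [← hx1 (u t)]
    refine h4 _ _ h5 h6 ?_ (hcr _ _)
    rw [← h3]
    exact hxcr (u t)

end IsReturnFunction

theorem AddCircle.continuous_coe (p : ℝ) : Continuous fun t : ℝ => (t : AddCircle p) :=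
  AddCircle.continuous_mk' p

theorem AddCircle.tendsto_of_tendsto_coe {p A : ℝ} (hp : 0 < p) {α : Type*} {l : Filter α}
    {f : α → ℝ} {y : ℝ} (hf : ∀ t, f t ∈ Ioo A (A + p)) (hy : y ∈ Ioo A (A + p))
    (h : Tendsto (fun t => (f t : AddCircle p)) l (𝓝 (y : AddCircle p))) :
    Tendsto f l (𝓝 y) := by
  have := Fact.mk hp
  have hne : (y : AddCircle p) ≠ (A : AddCircle p) := by
    intro heq
    have := (AddCircle.coe_eq_coe_iff_of_mem_Ico (Ioo_subset_Ico_self hy)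
      (left_mem_Ico.2 (by linarith))).1 heq
    linarith [hy.1]
  have := ((continuous_subtype_val.tendsto _).comp
    (AddCircle.continuousAt_equivIco p A hne)).comp h
  rw [AddCircle.equivIco_coe_of_mem (Ioo_subset_Ico_self hy)] at this
  refine this.congr fun t => ?_
  exact AddCircle.equivIco_coe_of_mem (Ioo_subset_Ico_self (hf t))

namespace IsCoding

variable {d γ a b k : ℝ} {F F' : ℝ → ℝ → ℝ} {ν : ℕ → ℤ} {x : (ℤ → ℕ) → ℝ × ℝ}

/-- The point of the annulus coded by a bi-infinite sequence. -/
noncomputable def toAnnulus (x : (ℤ → ℕ) → ℝ × ℝ) (s : ℤ → ℕ) : AddCircle (2 * Real.pi) × ℝ :=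
  ((x s).1, (x s).2)

theorem continuous_toAnnulus (hx : IsCoding d γ a b F ν x) : Continuous (toAnnulus x) :=
  ((AddCircle.continuous_coe _).comp (continuous_fst.comp hx.continuous)).prodMk
    (continuous_snd.comp hx.continuous)

theorem height_mem (h : IsReturnFunction d γ a b k F F') (hx : IsCoding d γ a b F ν x)
    (s : ℤ → ℕ) : (x s).2 ∈ Ioc (0 : ℝ) (1 / 1000) := by
  have h1 := hx.height fun i => s (i - 1)
  simp only [add_sub_cancel_right] at h1
  rw [h1]
  exact h.vert_mem (hx.pos _)

theorem coe_angle (hx : IsCoding d γ a b F ν x) (s : ℤ → ℕ) :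
    (((x s).1 + a - d * Real.log (F (x s).1 (x s).2) : ℝ) : AddCircle (2 * Real.pi)) =
      ((x fun i => s (i + 1)).1 : ℝ) := by
  rw [hx.angle s, AddCircle.coe_add, mul_comm (2 * Real.pi), ← zsmul_eq_mul, AddCircle.coe_zsmul,
    AddCircle.coe_period, smul_zero, add_zero]

theorem tendsto_of_coe (hx : IsCoding d γ a b F ν x) {α : Type*} {l : Filter α}
    {u : α → ℤ → ℕ} {s : ℤ → ℕ}
    (h1 : Tendsto (fun t => ((x (u t)).1 : AddCircle (2 * Real.pi))) l (𝓝 ((x s).1 : ℝ))) :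
    Tendsto (fun t => (x (u t)).1) l (𝓝 (x s).1) := by
  have hpi := Real.pi_pos
  have hmem : ∀ s, (x s).1 ∈ Ioo (-(Real.pi / 2)) (-(Real.pi / 2) + 2 * Real.pi) := fun s =>
    ⟨by linarith [(hx.mem s).1], by linarith [(hx.mem s).2]⟩
  exact AddCircle.tendsto_of_tendsto_coe Real.two_pi_pos (fun t => hmem _) (hmem s) h1

theorem tendsto_succ (h : IsReturnFunction d γ a b k F F') (hx : IsCoding d γ a b F ν x)
    {α : Type*} {l : Filter α} {u : α → ℤ → ℕ} {s : ℤ → ℕ}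
    (hu : Tendsto (fun t => x (u t)) l (𝓝 (x s))) :
    Tendsto (fun t => x fun i => u t (i + 1)) l (𝓝 (x fun i => s (i + 1))) := by
  have hF := (h.continuous.tendsto (x s)).comp hu
  have hF0 : F (x s).1 (x s).2 ≠ 0 := (hx.pos s).ne'
  have hlog : Tendsto (fun t => Real.log (F (x (u t)).1 (x (u t)).2)) l
      (𝓝 (Real.log (F (x s).1 (x s).2))) := hF.log hF0
  have h1 : Tendsto (fun t => (x (u t)).1) l (𝓝 (x s).1) := (continuous_fst.tendsto _).comp hu
  have hang : Tendsto (fun t => (x fun i => u t (i + 1)).1) l (𝓝 (x fun i => s (i + 1)).1) := by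
    refine hx.tendsto_of_coe ?_
    have := ((AddCircle.continuous_coe (2 * Real.pi)).tendsto _).comp
      ((h1.add_const a).sub (hlog.const_mul d))
    rw [hx.coe_angle s] at this
    exact this.congr fun t => hx.coe_angle (u t)
  have hht : Tendsto (fun t => (x fun i => u t (i + 1)).2) l (𝓝 (x fun i => s (i + 1)).2) := by
    rw [hx.height s]
    refine Tendsto.congr (fun t => (hx.height (u t)).symm) ?_
    exact (hF.rpow_const (Or.inl hF0)).const_mul b
  exact hang.prodMk_nhds hht

theorem tendsto_pred (h : IsReturnFunction d γ a b k F F') (hx : IsCoding d γ a b F ν x)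
    (hmono : ∀ θ, ∀ z ∈ Icc (-1 : ℝ) 1, ∀ z' ∈ Icc (-1 : ℝ) 1,
      k / 2 * |z - z'| ≤ |F θ z - F θ z'|)
    {α : Type*} {l : Filter α} {u : α → ℤ → ℕ} {s : ℤ → ℕ}
    (hu : Tendsto (fun t => x fun i => u t (i + 1)) l (𝓝 (x fun i => s (i + 1)))) :
    Tendsto (fun t => x (u t)) l (𝓝 (x s)) := by
  have hb := h.hb
  have hk := h.hk
  have hγ := h.hγ
  have hF0 : F (x s).1 (x s).2 ≠ 0 := (hx.pos s).ne'
  have hFe : ∀ s, ((x fun i => s (i + 1)).2 / b) ^ γ⁻¹ = F (x s).1 (x s).2 := by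
    intro s
    rw [hx.height s, mul_div_cancel_left₀ _ hb.ne', Real.rpow_rpow_inv (hx.pos s).le (by linarith)]
  have hF : Tendsto (fun t => F (x (u t)).1 (x (u t)).2) l (𝓝 (F (x s).1 (x s).2)) := by
    have h1 := (((continuous_snd.tendsto _).comp hu).div_const b).rpow_const (p := γ⁻¹)
      (Or.inr (by positivity))
    rw [hFe] at h1
    exact h1.congr fun t => hFe _
  have hang : Tendsto (fun t => (x (u t)).1) l (𝓝 (x s).1) := by
    refine hx.tendsto_of_coe ?_
    have e : ∀ s, (((x s).1 : ℝ) : AddCircle (2 * Real.pi)) =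
        (((x fun i => s (i + 1)).1 : ℝ) : AddCircle (2 * Real.pi)) +
          ((d * Real.log (F (x s).1 (x s).2) - a : ℝ) : AddCircle (2 * Real.pi)) := by
      intro s
      rw [← hx.coe_angle s, ← AddCircle.coe_add]
      congr 1
      ring
    rw [e s]
    refine Tendsto.congr (fun t => (e (u t)).symm) ?_
    have h1 := (continuous_fst.tendsto _).comp hu
    refine (((AddCircle.continuous_coe _).tendsto _).comp h1).add ?_
    exact ((AddCircle.continuous_coe _).tendsto _).comp (((hF.log hF0).const_mul d).sub_const a)
  have hmem : ∀ s, (x s).2 ∈ Icc (-1 : ℝ) 1 := fun s =>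
    ⟨by linarith [(hx.height_mem h s).1], by linarith [(hx.height_mem h s).2]⟩
  have hht : Tendsto (fun t => (x (u t)).2) l (𝓝 (x s).2) := by
    rw [tendsto_iff_dist_tendsto_zero]
    have h1 : Tendsto (fun t => F (x (u t)).1 (x s).2) l (𝓝 (F (x s).1 (x s).2)) :=
      (h.continuous.tendsto (x s)).comp (hang.prodMk_nhds tendsto_const_nhds)
    have h2 := ((hF.sub h1).abs).const_mul (2 / k)
    rw [sub_self, abs_zero, mul_zero] at h2
    refine squeeze_zero (fun _ => dist_nonneg) (fun t => ?_) h2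
    have h3 := hmono (x (u t)).1 _ (hmem (u t)) _ (hmem s)
    rw [Real.dist_eq]
    calc |(x (u t)).2 - (x s).2| = 2 / k * (k / 2 * |(x (u t)).2 - (x s).2|) := by
          field_simp
      _ ≤ _ := by gcongr
  exact hang.prodMk_nhds hht

theorem isEmbedding_toAnnulus (h : IsReturnFunction d γ a b k F F')
    (hx : IsCoding d γ a b F ν x)
    (hmono : ∀ θ, ∀ z ∈ Icc (-1 : ℝ) 1, ∀ z' ∈ Icc (-1 : ℝ) 1,
      k / 2 * |z - z'| ≤ |F θ z - F θ z'|) :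
    IsEmbedding (toAnnulus x) := by
  have hind : IsInducing (toAnnulus x) := by
    rw [isInducing_iff_nhds]
    intro s
    refine le_antisymm (hx.continuous_toAnnulus.tendsto s).le_comap ?_
    set l := comap (toAnnulus x) (𝓝 (toAnnulus x s)) with hl
    have h0 : Tendsto (toAnnulus x) l (𝓝 (toAnnulus x s)) := tendsto_comap
    have h1 : Tendsto x l (𝓝 (x s)) :=
      (hx.tendsto_of_coe (u := id) ((continuous_fst.tendsto (toAnnulus x s)).comp h0)).prodMk_nhds
        ((continuous_snd.tendsto (toAnnulus x s)).comp h0)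
    have h2 : ∀ n : ℤ, Tendsto (fun t : ℤ → ℕ => x fun i => t (i + n)) l
        (𝓝 (x fun i => s (i + n))) := by
      intro n
      induction n using Int.induction_on with
      | zero => simpa using h1
      | succ n ih =>
        have := hx.tendsto_succ h ih
        simpa only [add_assoc, add_comm (1 : ℤ)] using this
      | pred n ih =>
        refine hx.tendsto_pred h hmono ?_
        have e : ∀ i : ℤ, i + 1 + (-n - 1) = i + -n := fun i => by ring
        simpa only [e] using ih
    have h3 : Tendsto id l (𝓝 s) := by
      rw [tendsto_pi_nhds]
      intro n
      refine tendsto_pure.2 ?_ |>.mono_right (pure_le_nhds _)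
      have h4 := hx.symbol l (fun t i => t (i + n)) (fun i => s (i + n)) (h2 n) (by
        have e : ∀ i : ℤ, i + 1 + n = i + (n + 1) := fun i => by ring
        simpa only [e] using h2 (n + 1))
      simpa only [zero_add, id] using h4
    exact h3
  exact ⟨hind, hind.injective⟩

end IsCoding

/-- Bi-infinite orbits of the return map on the annulus are conjugate to the full shift. -/
theorem IsReturnFunction.exists_conjugacy {d γ a b k : ℝ} {F F' : ℝ → ℝ → ℝ}
    (h : IsReturnFunction d γ a b k F F')
    (hmono : ∀ θ, ∀ z ∈ Icc (-1 : ℝ) 1, ∀ z' ∈ Icc (-1 : ℝ) 1,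
      k / 2 * |z - z'| ≤ |F θ z - F θ z'|)
    {T : AddCircle (2 * Real.pi) × ℝ → AddCircle (2 * Real.pi) × ℝ}
    {V Λ : Set (AddCircle (2 * Real.pi) × ℝ)}
    (hT : ∀ θ z : ℝ, z ∈ Icc (-1 : ℝ) 1 →
      T (↑θ, z) = (↑(θ + a - d * Real.log (F θ z)), b * F θ z ^ γ))
    (hV : ∀ θ z : ℝ, ((θ : AddCircle (2 * Real.pi)), z) ∈ V ↔ z ∈ Icc (-1 : ℝ) 1 ∧ 0 < F θ z)
    (hΛ : Λ = {p | ∃ q : ℤ → AddCircle (2 * Real.pi) × ℝ,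
      q 0 = p ∧ (∀ i : ℤ, q i ∈ V) ∧ (∀ i : ℤ, T (q i) = q (i + 1))}) :
    ∃ e : (ℤ → ℕ) ≃ₜ Λ, ∀ s : ℤ → ℕ, T (e s) = e (fun i => s (i + 1)) := by
  obtain ⟨ν, x, hx⟩ := h.exists_isCoding
  have hmem : ∀ s, (x s).2 ∈ Icc (-1 : ℝ) 1 := fun s =>
    ⟨by linarith [(hx.height_mem h s).1], by linarith [(hx.height_mem h s).2]⟩
  have hTx : ∀ s, T (IsCoding.toAnnulus x s) = IsCoding.toAnnulus x fun i => s (i + 1) := by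
    intro s
    rw [IsCoding.toAnnulus, hT _ _ (hmem s), hx.coe_angle, ← hx.height]
    rfl
  have hrange : range (IsCoding.toAnnulus x) = Λ := by
    rw [hΛ]
    refine Subset.antisymm ?_ ?_
    · rintro _ ⟨s, rfl⟩
      refine ⟨fun n => IsCoding.toAnnulus x fun i => s (i + n), by simp, fun n => ?_, fun n => ?_⟩
      · exact (hV _ _).2 ⟨hmem _, hx.pos _⟩
      · rw [hTx]
        have e : ∀ i : ℤ, i + 1 + n = i + (n + 1) := fun i => by ring
        simp only [e]
    · rintro p ⟨q, rfl, hqV, hqT⟩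
      have := Fact.mk Real.two_pi_pos
      let θ : ℤ → ℝ := fun i => AddCircle.equivIco (2 * Real.pi) (-(Real.pi / 2)) (q i).1
      have hθ : ∀ i, q i = ((θ i : AddCircle (2 * Real.pi)), (q i).2) := fun i =>
        Prod.ext AddCircle.coe_equivIco.symm rfl
      have hθm : ∀ i, θ i ∈ Icc (-(Real.pi / 2)) (3 * Real.pi / 2) := by
        intro i
        have h1 := (AddCircle.equivIco (2 * Real.pi) (-(Real.pi / 2)) (q i).1).2
        exact ⟨h1.1, by linarith [h1.2]⟩
      have hpos : ∀ i, (q i).2 ∈ Icc (-1 : ℝ) 1 ∧ 0 < F (θ i) (q i).2 := by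
        intro i
        have h1 := hqV i
        rw [hθ i] at h1
        exact (hV _ _).1 h1
      have hstep : ∀ i, ((θ i + a - d * Real.log (F (θ i) (q i).2) : ℝ) :
          AddCircle (2 * Real.pi)) = θ (i + 1) ∧ b * F (θ i) (q i).2 ^ γ = (q (i + 1)).2 := by
        intro i
        have h1 := hqT i
        rw [hθ i, hT _ _ (hpos i).1, hθ (i + 1)] at h1
        exact Prod.ext_iff.1 h1
      have hwind : ∀ i, ∃ m : ℤ, θ i + a - d * Real.log (F (θ i) (q i).2) =
          θ (i + 1) + 2 * Real.pi * m := by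
        intro i
        have h1 := (hstep i).1
        rw [← sub_eq_zero, ← AddCircle.coe_sub, AddCircle.coe_eq_zero_iff] at h1
        obtain ⟨m, hm⟩ := h1
        rw [zsmul_eq_mul] at hm
        exact ⟨m, by linarith⟩
      choose m hm using hwind
      obtain ⟨s, hs⟩ := hx.complete (fun i => (θ i, (q i).2)) m hθm (fun i => (hpos i).2) hm
        fun i => (hstep i).2.symm
      refine ⟨s, ?_⟩
      rw [IsCoding.toAnnulus, hs, hθ 0]
  refine ⟨(hx.isEmbedding_toAnnulus h hmono).toHomeomorph.trans (Homeomorph.setCongr hrange),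
    fun s => hTx s⟩

/-- Truncation of a real number to `[-1, 1]`. -/
noncomputable def truncate (z : ℝ) : ℝ := max (-1) (min z 1)

theorem truncate_mem (z : ℝ) : truncate z ∈ Icc (-1 : ℝ) 1 :=
  ⟨le_max_left _ _, max_le (by norm_num) (min_le_right _ _)⟩

theorem truncate_eq {z : ℝ} (hz : z ∈ Icc (-1 : ℝ) 1) : truncate z = z := by
  rw [truncate, min_eq_left hz.2, max_eq_right hz.1]

theorem abs_truncate_sub_le (z z' : ℝ) : |truncate z - truncate z'| ≤ |z - z'| :=
  ((abs_max_sub_max_le_max _ _ _ _).trans (by simp)).trans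
    ((abs_min_sub_min_le_max z 1 z' 1).trans (by simp))

theorem abs_sub_le_of_abs_deriv_le {f : ℝ → ℝ} {C : ℝ} (hf : Differentiable ℝ f)
    (hC : ∀ t, |deriv f t| ≤ C) (z z' : ℝ) : |f z - f z'| ≤ C * |z - z'| :=
  convex_univ.norm_image_sub_le_of_norm_deriv_le (fun t _ => hf t) (fun t _ => hC t)
    (mem_univ z') (mem_univ z)

theorem continuous_uncurry_deriv {E : ℝ → ℝ → ℝ} (hE : ContDiff ℝ 1 (Function.uncurry E)) :
    Continuous (Function.uncurry fun θ z => deriv (fun t => E t z) θ) := by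
  have h1 : Continuous fun p : ℝ × ℝ => fderiv ℝ (Function.uncurry E) p (1, 0) :=
    (hE.continuous_fderiv one_ne_zero).clm_apply continuous_const
  refine h1.congr ?_
  rintro ⟨θ, z⟩
  have h2 : HasDerivAt (fun t : ℝ => (t, z)) ((1 : ℝ), (0 : ℝ)) θ :=
    (hasDerivAt_id θ).prodMk (hasDerivAt_const θ z)
  exact (((hE.differentiable one_ne_zero (θ, z)).hasFDerivAt.comp_hasDerivAt θ h2).deriv).symm

theorem sin_le_of_mem_left {θ : ℝ} (hθ : θ ∈ Icc (-(Real.pi / 2)) (-(Real.pi / 4))) :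
    Real.sin θ ≤ -(7 / 10) := by
  have hpi := Real.pi_pos
  have h1 : Real.sin θ ≤ Real.sin (-(Real.pi / 4)) :=
    Real.sin_le_sin_of_le_of_le_pi_div_two hθ.1 (by linarith) hθ.2
  rw [Real.sin_neg, Real.sin_pi_div_four] at h1
  have h2 : (7 / 5 : ℝ) ≤ √2 := Real.le_sqrt_of_sq_le (by norm_num)
  linarith

theorem cos_ge_of_mem {θ : ℝ} (hθ : θ ∈ Icc (-(Real.pi / 4)) (Real.pi / 4)) :
    7 / 10 ≤ Real.cos θ := by
  have hpi := Real.pi_pos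
  have h1 : Real.cos (Real.pi / 4) ≤ Real.cos |θ| :=
    Real.cos_le_cos_of_nonneg_of_le_pi (abs_nonneg _) (by linarith) (abs_le.2 hθ)
  rw [Real.cos_abs, Real.cos_pi_div_four] at h1
  have h2 : (7 / 5 : ℝ) ≤ √2 := Real.le_sqrt_of_sq_le (by norm_num)
  linarith

theorem exists_isReturnFunction {d γ c a k b : ℝ} {E : ℝ → ℝ → ℝ}
    (hd : 100 ≤ d) (hγ : 1 < γ) (hc : c ∈ Icc (2 : ℝ) 10) (hk : 0 < k) (hb : 0 < b)
    (hdk : d * Real.sqrt k ≤ 1 / 100) (hγb : γ * b * (12 : ℝ) ^ γ ≤ 1 / 10000)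
    (hE : ContDiff ℝ 1 (Function.uncurry E))
    (hEbd : ∀ θ z : ℝ, |E θ z| + |deriv (fun t => E t z) θ| ≤ 1 / 50 ∧
      |deriv (fun t => E θ t) z| ≤ k / 2)
    (hEper : ∀ θ z : ℝ, E (θ + 2 * Real.pi) z = E θ z)
    {F : ℝ → ℝ → ℝ} (hF : F = fun θ z => 1 + c * Real.sin θ + k * z + E θ z)
    (hfold : ∀ θ z : ℝ, z ∈ Icc (-1 : ℝ) 1 → 0 < F θ z →
      |1 - d * (deriv (fun t => F t z) θ) / F θ z| < 2 →
      F (θ + a - d * Real.log (F θ z)) (b * F θ z ^ γ) < 0) :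
    ∃ F', IsReturnFunction d γ a b k (fun θ z => F θ (truncate z)) F' ∧
      ∀ θ, ∀ z ∈ Icc (-1 : ℝ) 1, ∀ z' ∈ Icc (-1 : ℝ) 1,
        k / 2 * |z - z'| ≤ |F θ (truncate z) - F θ (truncate z')| := by
  have hpi := Real.pi_pos
  have hs : 0 < Real.sqrt k := Real.sqrt_pos.2 hk
  have hss : Real.sqrt k * Real.sqrt k = k := Real.mul_self_sqrt hk.le
  have hs4 : Real.sqrt k ≤ 1 / 10000 := by nlinarith
  have hdk' : d * k ≤ 1 / 1000000 := by
    rw [← hss]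
    nlinarith
  have hk8 : k ≤ 1 / 100000000 := by nlinarith
  have hE1 : ∀ θ z, |E θ z| ≤ 1 / 50 := fun θ z => by
    linarith [(hEbd θ z).1, abs_nonneg (deriv (fun t => E t z) θ)]
  have hE2 : ∀ θ z, |deriv (fun t => E t z) θ| ≤ 1 / 50 := fun θ z => by
    linarith [(hEbd θ z).1, abs_nonneg (E θ z)]
  have hEd : Differentiable ℝ (Function.uncurry E) := hE.differentiable one_ne_zero
  have hElip : ∀ θ z z', |E θ z - E θ z'| ≤ k / 2 * |z - z'| := fun θ =>
    abs_sub_le_of_abs_deriv_le (f := fun t => E θ t)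
      (hEd.comp ((differentiable_const θ).prodMk differentiable_id)) fun z => (hEbd θ z).2
  have hder : ∀ θ z, HasDerivAt (fun t => F t z) (c * Real.cos θ + deriv (fun t => E t z) θ) θ := by
    intro θ z
    have h1 : DifferentiableAt ℝ (fun t => E t z) θ :=
      hEd.comp (differentiable_id.prodMk (differentiable_const z)) θ
    have h2 := ((((Real.hasDerivAt_sin θ).const_mul c).const_add 1).add_const (k * z)).add
      h1.hasDerivAt
    rw [hF]
    exact h2
  have hFE : ∀ θ z, F θ z = 1 + c * Real.sin θ + k * z + E θ z := fun θ z => by rw [hF]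
  have hdiff : ∀ θ z z', F θ z - F θ z' = k * (z - z') + (E θ z - E θ z') := fun θ z z' => by
    rw [hFE, hFE]
    ring
  have hkz : ∀ z, |k * truncate z| ≤ 1 / 1000 := by
    intro z
    have := truncate_mem z
    rw [abs_le]
    constructor <;> nlinarith [this.1, this.2]
  have hb1 : ∀ θ z, F θ (truncate z) ≤ 1 + c * Real.sin θ + 21 / 1000 := fun θ z => by
    rw [hFE]
    linarith [le_abs_self (k * truncate z), hkz z, hE1 θ (truncate z), le_abs_self (E θ (truncate z))]
  have hb2 : ∀ θ z, 1 + c * Real.sin θ - 21 / 1000 ≤ F θ (truncate z) := fun θ z => by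
    rw [hFE]
    linarith [neg_abs_le (k * truncate z), hkz z, hE1 θ (truncate z), neg_abs_le (E θ (truncate z))]
  have hc2 := hc.1
  have hc10 := hc.2
  have hret : IsReturnFunction d γ a b k (fun θ z => F θ (truncate z))
      (fun θ z => c * Real.cos θ + deriv (fun t => E t (truncate z)) θ) := by
    refine ⟨hd, hγ, hb, hk, hdk', hγb, fun θ z => hder θ _, ?_, ?_, ?_, ?_, ?_, ?_, ?_, ?_, ?_, ?_, ?_⟩
    · have htr : Continuous truncate := by
        unfold truncate
        fun_prop
      refine (by fun_prop : Continuous fun p : ℝ × ℝ => c * Real.cos p.1).add ?_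
      exact (continuous_uncurry_deriv hE).comp (continuous_fst.prodMk (htr.comp continuous_snd))
    · intro θ z z'
      rw [hdiff]
      refine (abs_add_le _ _).trans ?_
      rw [abs_mul, abs_of_pos hk]
      have h1 := hElip θ (truncate z) (truncate z')
      have h2 := abs_truncate_sub_le z z'
      have h3 := abs_nonneg (z - z')
      nlinarith
    · intro θ z
      have := hb1 θ z
      nlinarith [Real.sin_le_one θ]
    · intro θ z
      refine (abs_add_le _ _).trans ?_
      rw [abs_mul, abs_of_nonneg (by linarith)]
      nlinarith [hE2 θ (truncate z), Real.abs_cos_le_one θ]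
    · intro θ z
      rw [hFE, hFE, hEper, Real.sin_add_two_pi]
    · intro θ hθ z
      have := hb1 θ z
      nlinarith [sin_le_of_mem_left hθ]
    · intro θ hθ z
      have := hb1 θ z
      have h2 := sin_le_of_mem_left (θ := Real.pi - θ)
        ⟨by linarith [hθ.2], by linarith [hθ.1]⟩
      rw [Real.sin_pi_sub] at h2
      nlinarith
    · intro θ hθ z
      have := hb2 θ z
      have h2 := Real.sin_nonneg_of_mem_Icc hθ
      nlinarith
    · intro θ hθ z
      have h1 := hb1 θ z
      have h2 := Real.sin_nonpos_of_nonpos_of_neg_pi_le hθ.2 (by linarith [hθ.1])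
      have h3 := cos_ge_of_mem (θ := θ) ⟨hθ.1, by linarith [hθ.2]⟩
      have h4 := abs_le.1 (hE2 θ (truncate z))
      exact ⟨by nlinarith [h4.1], by nlinarith⟩
    · intro θ hθ z
      have h1 := hb1 θ z
      have h2 := Real.sin_nonpos_of_nonpos_of_neg_pi_le (x := Real.pi - θ)
        (by linarith [hθ.1]) (by linarith [hθ.2])
      have h3 := cos_ge_of_mem (θ := Real.pi - θ)
        ⟨by linarith [hθ.2], by linarith [hθ.1]⟩
      rw [Real.sin_pi_sub] at h2
      rw [Real.cos_pi_sub] at h3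
      have h4 := abs_le.1 (hE2 θ (truncate z))
      exact ⟨by nlinarith [h4.2], by nlinarith⟩
    · intro θ z hpos hlt
      have h1 : b * F θ (truncate z) ^ γ ≤ γ * b * (12 : ℝ) ^ γ := by
        have h2 : F θ (truncate z) ^ γ ≤ (12 : ℝ) ^ γ :=
          Real.rpow_le_rpow hpos.le (by nlinarith [hb1 θ z, Real.sin_le_one θ]) (by linarith)
        have h3 : b ≤ γ * b := by nlinarith
        gcongr
      have h2 : 0 ≤ b * F θ (truncate z) ^ γ := by positivity
      rw [truncate_eq (z := b * F θ (truncate z) ^ γ) ⟨by linarith, by linarith⟩]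
      refine hfold θ _ (truncate_mem z) hpos ?_
      rwa [(hder θ (truncate z)).deriv]
  refine ⟨_, hret, fun θ z hz z' hz' => ?_⟩
  rw [truncate_eq hz, truncate_eq hz', hdiff]
  have h1 := hElip θ z z'
  have h2 := abs_sub_abs_le_abs_add (k * (z - z')) (E θ z - E θ z')
  rw [abs_mul, abs_of_pos hk] at h2
  linarith

end

/-- Theorem 1 of the paper (model form): if the image of the fold region lies in
the escape strip, the set Λ of points of the annulus with a bi-infinite orbit in
V is a horseshoe: T on Λ is topologically conjugate to the full two-sided shift
on countably many symbols. -/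
theorem stmt18 (d γ c a k b : ℝ) (E : ℝ → ℝ → ℝ)
    (hd : 100 ≤ d) (hγ : 1 < γ) (hc : c ∈ Set.Icc (2:ℝ) 10)
    (hk : 0 < k) (hb : 0 < b)
    (hdk : d * Real.sqrt k ≤ 1/100)
    (hγb : γ * b * (12:ℝ) ^ γ ≤ 1/10000)
    (hE : ContDiff ℝ 1 (Function.uncurry E))
    (hEbd : ∀ θ z : ℝ, |E θ z| + |deriv (fun t => E t z) θ| ≤ 1/50 ∧
      |deriv (fun t => E θ t) z| ≤ k/2)
    (hEper : ∀ θ z : ℝ, E (θ + 2 * Real.pi) z = E θ z)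
    (F T₁ T₂ : ℝ → ℝ → ℝ)
    (hF : F = fun θ z => 1 + c * Real.sin θ + k * z + E θ z)
    (hT₁ : T₁ = fun θ z => θ + a - d * Real.log (F θ z))
    (hT₂ : T₂ = fun θ z => b * (F θ z) ^ γ)
    (Fbar : AddCircle (2 * Real.pi) × ℝ → ℝ)
    (hFbar : ∀ θ z : ℝ, Fbar (↑θ, z) = F θ z)
    (Tbar : AddCircle (2 * Real.pi) × ℝ → AddCircle (2 * Real.pi) × ℝ)
    (hTbar : ∀ θ z : ℝ, Tbar (↑θ, z) = (↑(T₁ θ z), T₂ θ z))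
    (Vbar : Set (AddCircle (2 * Real.pi) × ℝ))
    (hVbar : Vbar = {p | p.2 ∈ Set.Icc (-1:ℝ) 1 ∧ 0 < Fbar p})
    (hfold : ∀ θ z : ℝ, z ∈ Set.Icc (-1:ℝ) 1 → 0 < F θ z →
      |1 - d * (deriv (fun t => F t z) θ) / F θ z| < 2 →
      F (T₁ θ z) (T₂ θ z) < 0)
    (Λ : Set (AddCircle (2 * Real.pi) × ℝ))
    (hΛ : Λ = {p | ∃ q : ℤ → AddCircle (2 * Real.pi) × ℝ,
      q 0 = p ∧ (∀ i : ℤ, q i ∈ Vbar) ∧ (∀ i : ℤ, Tbar (q i) = q (i + 1))}) :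
    ∃ h : (ℤ → ℕ) ≃ₜ Λ,
      ∀ s : ℤ → ℕ,
        Tbar ((h s : AddCircle (2 * Real.pi) × ℝ)) =
          ((h (fun i => s (i + 1)) : AddCircle (2 * Real.pi) × ℝ)) := by
  subst hT₁ hT₂ hVbar
  obtain ⟨F', h, hmono⟩ := exists_isReturnFunction (γ := γ) (a := a) (b := b) hd hγ hc hk hb hdk
    hγb hE hEbd hEper hF hfold
  refine h.exists_conjugacy hmono (T := Tbar) (fun θ z hz => ?_) (fun θ z => ?_) hΛ
  · rw [hTbar, truncate_eq hz]
  · rw [Set.mem_ofPred_eq, hFbar]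
    refine and_congr_right fun hz => ?_
    rw [truncate_eq hz]
end
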